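/- Let P be a polynomial of degree at most d on ℝⁿ, and let F ⊂ ℝⁿ be a compact convex set of volume 1. Then for every c > 0 and every λ ≥ 1, Vol{x ∈ F : |P(x)| ≥ (4λ)^d c} ≤ (Vol{x ∈ F : |P(x)| ≥ c})^λ. -/

import Mathlib

open MeasureTheory

open Polynomial.Chebyshev in
theorem sum_inv_prod_abs_node_sub_node (d : ℕ) :
    ∑ i ∈ Finset.Iic d, ∏ j ∈ (Finset.Iic d).erase i, |node d i - node d j|⁻¹ = 2 ^ (d - 1) := by
  have hdeg : (T ℝ d).degree = d := by simp [degree_T]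
  have hlc : (T ℝ d).leadingCoeff = 2 ^ (d - 1) := by
    simp [leadingCoeff_T]
  rw [← hlc, Lagrange.leadingCoeff_eq_sum (s := Finset.Iic d) (v := node d)
    (fun i hi j hj h => (strictAntiOn_node d).injOn (by simpa using hi) (by simpa using hj) h)
    (by rw [hdeg]; simp)]
  refine Finset.sum_congr rfl fun i hi => ?_
  have hpos := zero_lt_prod_node_sub_node (n := d) (i := i) (by simpa using hi)
  rw [Nat.range_succ_eq_Iic] at hpos
  rw [eval_T_real_node hi, Finset.prod_inv_distrib, ← Finset.abs_prod]
  rcases neg_one_pow_eq_or ℝ i with h | h <;> rw [h] at hpos ⊢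
  · rw [abs_of_pos (by linarith)]; simp
  · rw [abs_of_neg (by linarith)]; field_simp

theorem exists_mem_volume_inter_Icc_eq {E : Set ℝ} (hE : IsCompact E) (hne : E.Nonempty) {v : ℝ}
    (hv : 0 ≤ v) (hvE : v ≤ volume.real E) :
    ∃ x ∈ E, volume.real (E ∩ Set.Iic x) = v := by
  obtain ⟨a, ha, ha'⟩ := hE.exists_isLeast hne
  obtain ⟨b, hb, hb'⟩ := hE.exists_isGreatest hne
  have hab : a ≤ b := ha' hb
  set G : ℝ → ℝ := fun s => volume.real (E ∩ Set.Iic s) with hG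
  have hfin : ∀ s, volume (E ∩ Set.Iic s) ≠ ⊤ := fun s =>
    ((measure_mono Set.inter_subset_left).trans_lt hE.measure_lt_top).ne
  have hdiff : ∀ s t, s ≤ t → G t ≤ G s + (t - s) := by
    intro s t hst
    have hsub : E ∩ Set.Iic t ⊆ (E ∩ Set.Iic s) ∪ Set.Ioc s t := by
      rintro x ⟨hx, hxt⟩
      by_cases h : x ≤ s
      · exact Or.inl ⟨hx, h⟩
      · exact Or.inr ⟨not_le.1 h, hxt⟩
    calc G t ≤ volume.real ((E ∩ Set.Iic s) ∪ Set.Ioc s t) :=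
          measureReal_mono hsub (measure_union_ne_top (hfin s) (by simp))
      _ ≤ _ := (measureReal_union_le _ _).trans (by simp [hG, hst])
  have hmono : Monotone G := fun s t hst =>
    measureReal_mono (Set.inter_subset_inter_right _ (Set.Iic_subset_Iic.2 hst)) (hfin t)
  have hcont : Continuous G := by
    refine (LipschitzWith.of_dist_le_mul (K := 1) fun s t => ?_).continuous
    rw [Real.dist_eq, Real.dist_eq, NNReal.coe_one, one_mul]
    rcases le_total s t with h | h
    · rw [abs_sub_comm, abs_sub_comm s, abs_of_nonneg (by linarith [hmono h]),
        abs_of_nonneg (by linarith)]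
      linarith [hdiff s t h]
    · rw [abs_of_nonneg (by linarith [hmono h]), abs_of_nonneg (by linarith)]
      linarith [hdiff t s h]
  have hGa : G a ≤ v := by
    have : E ∩ Set.Iic a ⊆ {a} := fun x hx => le_antisymm hx.2 (ha' hx.1)
    have h0 : volume (E ∩ Set.Iic a) = 0 := measure_mono_null this (by simp)
    simpa [hG, measureReal_def, h0] using hv
  have hGb : v ≤ G b := by
    have : E ∩ Set.Iic b = E := Set.inter_eq_left.2 fun x hx => hb' hx
    simpa [hG, this] using hvE
  obtain ⟨s, hs, hsv⟩ := intermediate_value_Icc hab hcont.continuousOn ⟨hGa, hGb⟩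
  obtain ⟨x, hx, hx'⟩ := (hE.inter_right (isClosed_Iic (a := s))).exists_isGreatest ⟨a, ha, hs.1⟩
  refine ⟨x, hx.1, ?_⟩
  rw [← hsv]
  congr 1
  ext y
  exact ⟨fun h => ⟨h.1, Set.mem_Iic.2 ((Set.mem_Iic.1 h.2).trans (Set.mem_Iic.1 hx.2))⟩, fun h => ⟨h.1, hx' h⟩⟩

open Polynomial.Chebyshev in
/-- **Remez inequality**. -/
theorem remez_inequality {d : ℕ} (hd : d ≠ 0) {p : Polynomial ℝ} (hp : p.natDegree ≤ d)
    {c s t x : ℝ} (hc : 0 ≤ c) (hx : x ∈ Set.Icc s t) {E : Set ℝ} (hE : IsCompact E)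
    (hEJ : E ⊆ Set.Icc s t) (hEp : ∀ y ∈ E, |p.eval y| ≤ c) (hpos : 0 < volume.real E) :
    |p.eval x| ≤ (4 * (t - s) / volume.real E) ^ d * c / 2 := by
  set l := volume.real E with hl
  have hne : E.Nonempty := by
    by_contra h
    rw [Set.not_nonempty_iff_eq_empty] at h
    simp [hl, h] at hpos
  have hnode : ∀ i, ∃ y ∈ E, volume.real (E ∩ Set.Iic y) = l * (1 + node d i) / 2 := fun i => by
    have := node_mem_Icc (n := d) (i := i)
    refine exists_mem_volume_inter_Icc_eq hE hne ?_ ?_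
    · have : 0 ≤ 1 + node d i := by linarith [this.1]
      positivity
    · rw [← hl]; nlinarith [this.2]
  choose y hyE hy using hnode
  have hle : ∀ a b, a ≤ b → volume.real (E ∩ Set.Iic b) - volume.real (E ∩ Set.Iic a) ≤ b - a := by
    intro a b hab
    have hsub : E ∩ Set.Iic b ⊆ (E ∩ Set.Iic a) ∪ Set.Ioc a b := by
      rintro x ⟨hx, hxt⟩
      by_cases h : x ≤ a
      · exact Or.inl ⟨hx, h⟩
      · exact Or.inr ⟨not_le.1 h, hxt⟩
    have hfin : volume (E ∩ Set.Iic a) ≠ ⊤ :=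
      ((measure_mono Set.inter_subset_left).trans_lt hE.measure_lt_top).ne
    have := (measureReal_mono hsub (measure_union_ne_top hfin (by simp))).trans
      (measureReal_union_le _ _)
    simp [hab] at this
    linarith
  have hsep : ∀ i j, l / 2 * |node d i - node d j| ≤ |y i - y j| := by
    have key : ∀ i j, y i ≤ y j → l / 2 * |node d i - node d j| ≤ |y i - y j| := by
      intro i j hij
      have h1 := hle _ _ hij
      have h2 : volume.real (E ∩ Set.Iic (y i)) ≤ volume.real (E ∩ Set.Iic (y j)) :=
        measureReal_mono (Set.inter_subset_inter_right _ (Set.Iic_subset_Iic.2 hij))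
          ((measure_mono Set.inter_subset_left).trans_lt hE.measure_lt_top).ne
      rw [hy, hy] at h1 h2
      rw [abs_sub_comm (y i), abs_of_nonneg (sub_nonneg.2 hij), abs_sub_comm, abs_of_nonneg]
      · linarith
      · nlinarith
    intro i j
    rcases le_total (y i) (y j) with h | h
    · exact key i j h
    · rw [abs_sub_comm, abs_sub_comm (y i)]; exact key j i h
  have hnpos : ∀ i ∈ Finset.Iic d, ∀ j ∈ Finset.Iic d, i ≠ j → 0 < |node d i - node d j| := by
    intro i hi j hj hij
    rw [abs_pos, sub_ne_zero]
    exact fun h => hij ((strictAntiOn_node d).injOn (by simpa using hi) (by simpa using hj) h)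
  have hinj : Set.InjOn y (Finset.Iic d : Finset ℕ) := by
    intro i hi j hj hij
    by_contra hne
    have := hsep i j
    rw [hij, sub_self, abs_zero] at this
    have h2 := hnpos i hi j hj hne
    have : 0 < l / 2 * |node d i - node d j| := by positivity
    linarith
  have hinterp := Lagrange.eq_interpolate_of_eval_eq (s := Finset.Iic d) (v := y) (f := p)
    (fun i => p.eval (y i)) hinj
    (by
      refine lt_of_le_of_lt (Polynomial.degree_le_natDegree) ?_
      simp only [Nat.card_Iic]
      exact_mod_cast Nat.lt_succ_of_le hp) (fun i _ => rfl)
  have hts : 0 ≤ t - s := by linarith [hx.1, hx.2]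
  calc |p.eval x| = |∑ i ∈ Finset.Iic d, p.eval (y i) *
        ∏ j ∈ (Finset.Iic d).erase i, ((y i - y j)⁻¹ * (x - y j))| := by
        conv_lhs => rw [hinterp]
        simp [Lagrange.interpolate_apply, Polynomial.eval_finsetSum, Lagrange.basis,
          Polynomial.eval_prod, Lagrange.basisDivisor]
    _ ≤ ∑ i ∈ Finset.Iic d, c * ∏ j ∈ (Finset.Iic d).erase i,
          (2 * (t - s) / l * |node d i - node d j|⁻¹) := by
        refine (Finset.abs_sum_le_sum_abs _ _).trans (Finset.sum_le_sum fun i hi => ?_)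
        rw [abs_mul, Finset.abs_prod]
        refine mul_le_mul (hEp _ (hyE i)) ?_ (Finset.prod_nonneg fun _ _ => abs_nonneg _) hc
        refine Finset.prod_le_prod (fun _ _ => abs_nonneg _) fun j hj => ?_
        have h0 := hnpos i hi j (Finset.mem_of_mem_erase hj) (Finset.ne_of_mem_erase hj).symm
        have h1 : |x - y j| ≤ t - s := by
          have := hEJ (hyE j)
          rw [abs_le]; constructor <;> linarith [this.1, this.2, hx.1, hx.2]
        rw [abs_mul, abs_inv]
        calc |y i - y j|⁻¹ * |x - y j| ≤ (l / 2 * |node d i - node d j|)⁻¹ * (t - s) :=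
              mul_le_mul (inv_anti₀ (by positivity) (hsep i j)) h1 (abs_nonneg _) (by positivity)
          _ = _ := by field_simp
    _ = (2 * (t - s) / l) ^ d * c * 2 ^ (d - 1) := by
        rw [← sum_inv_prod_abs_node_sub_node d, Finset.mul_sum]
        refine Finset.sum_congr rfl fun i hi => ?_
        rw [Finset.prod_mul_distrib, Finset.prod_const, Finset.card_erase_of_mem hi, Nat.card_Iic]
        simp; ring
    _ = _ := by
        obtain ⟨e, rfl⟩ := Nat.exists_eq_succ_of_ne_zero hd
        have : 4 * (t - s) / l = 2 * (t - s) / l * 2 := by ring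
        rw [this, mul_pow]; simp [pow_succ]; ring

/-- The intervals through a point where `|p|` is large mostly avoid the sublevel set. -/
theorem volume_sublevel_inter_Icc_le {d : ℕ} (hd : d ≠ 0) {p : Polynomial ℝ}
    (hp : p.natDegree ≤ d) {c lam s t x : ℝ} (hc : 0 < c) (hlam : 0 < lam)
    (hx : x ∈ Set.Icc s t) (hpx : (4 * lam) ^ d * c / 2 ≤ |p.eval x|) :
    volume.real ({y | |p.eval y| < c} ∩ Set.Icc s t) ≤ lam⁻¹ * (t - s) := by
  set E := {y | |p.eval y| ≤ c} ∩ Set.Icc s t with hE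
  have hEc : IsCompact E :=
    isCompact_Icc.inter_left (isClosed_le (by fun_prop) continuous_const)
  have hts : 0 ≤ t - s := by linarith [hx.1, hx.2]
  have hle : volume.real ({y | |p.eval y| < c} ∩ Set.Icc s t) ≤ volume.real E :=
    measureReal_mono (Set.inter_subset_inter_left _ fun y (hy : _ < c) => le_of_lt hy)
      hEc.measure_lt_top.ne
  refine hle.trans ?_
  rcases (measureReal_nonneg (μ := volume) (s := E)).eq_or_lt with h | h
  · rw [← h]; positivity
  have h1 := hpx.trans (remez_inequality hd hp hc.le hx hEc Set.inter_subset_right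
    (fun y hy => hy.1) h)
  have h2 : (4 * lam) ^ d ≤ (4 * (t - s) / volume.real E) ^ d := by
    have h3 : (4 * lam) ^ d * c ≤ (4 * (t - s) / volume.real E) ^ d * c := by linarith
    exact le_of_mul_le_mul_right h3 hc
  have h3 := le_of_pow_le_pow_left₀ hd (by positivity) h2
  rw [le_div_iff₀ h] at h3
  rw [inv_mul_eq_div, le_div_iff₀ hlam]
  linarith

open scoped Pointwise ENNReal in
theorem volume_add_le_volume_add_of_isCompact {A B : Set ℝ} (hA : IsCompact A) (hB : IsCompact B)
    (hA' : A.Nonempty) (hB' : B.Nonempty) : volume A + volume B ≤ volume (A + B) := by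
  obtain ⟨a, ha, ha'⟩ := hA.exists_isGreatest hA'
  obtain ⟨b, hb, hb'⟩ := hB.exists_isLeast hB'
  have h1 : volume (b +ᵥ A) = volume A := measure_vadd _ _ _
  have h2 : volume (a +ᵥ B) = volume B := measure_vadd _ _ _
  have hd : AEDisjoint volume (b +ᵥ A) (a +ᵥ B) := by
    refine measure_mono_null (t := {a + b}) ?_ (by simp)
    rintro x ⟨⟨y, hy, rfl⟩, ⟨z, hz, hyz⟩⟩
    have := ha' hy
    have := hb' hz
    simp only [vadd_eq_add] at hyz
    simp only [vadd_eq_add, Set.mem_singleton_iff]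
    linarith
  rw [← h1, ← h2, ← measure_union₀ (hB.vadd a).measurableSet.nullMeasurableSet hd]
  refine measure_mono (Set.union_subset ?_ ?_)
  · rintro _ ⟨y, hy, rfl⟩
    exact ⟨y, hy, b, hb, by simp [add_comm]⟩
  · rintro _ ⟨y, hy, rfl⟩
    exact ⟨a, ha, y, hy, by simp⟩

open scoped Pointwise ENNReal in
theorem volume_add_le_of_add_subset {A B C : Set ℝ} (hA : MeasurableSet A) (hB : MeasurableSet B)
    (hA' : A.Nonempty) (hB' : B.Nonempty) (hC : A + B ⊆ C) :
    volume A + volume B ≤ volume C := by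
  obtain ⟨a, ha⟩ := hA'
  obtain ⟨b, hb⟩ := hB'
  rw [hA.measure_eq_iSup_isCompact, hB.measure_eq_iSup_isCompact]
  simp only [iSup_and']
  refine ENNReal.biSup_add_biSup_le' ⟨∅, by simp⟩ ⟨∅, by simp⟩ ?_
  rintro K ⟨hKA, hK⟩ L ⟨hLB, hL⟩
  calc volume K + volume L ≤ volume (insert a K) + volume (insert b L) := by
        gcongr <;> exact Set.subset_insert _ _
    _ ≤ volume (insert a K + insert b L) :=
        volume_add_le_volume_add_of_isCompact (hK.insert a) (hL.insert b)
          (Set.insert_nonempty _ _) (Set.insert_nonempty _ _)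
    _ ≤ volume C := measure_mono ((Set.add_subset_add (Set.insert_subset ha hKA)
          (Set.insert_subset hb hLB)).trans hC)

open scoped ENNReal in
theorem lintegral_eq_setLIntegral_Ioo_volume_lt {f : ℝ → ℝ≥0∞} (hf : Measurable f)
    (hf1 : ∀ x, f x ≤ 1) :
    ∫⁻ x, f x = ∫⁻ s in Set.Ioo 0 1, volume {x | ENNReal.ofReal s < f x} := by
  have hfin : ∀ x, f x ≠ ∞ := fun x => ((hf1 x).trans_lt ENNReal.one_lt_top).ne
  have h := lintegral_eq_lintegral_meas_lt (volume : Measure ℝ) (f := fun x => (f x).toReal)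
    (Filter.Eventually.of_forall fun _ => ENNReal.toReal_nonneg) hf.ennreal_toReal.aemeasurable
  simp only [ENNReal.ofReal_toReal (hfin _)] at h
  rw [h, ← Set.Ioo_union_Ici_eq_Ioi (zero_lt_one (α := ℝ)),
    lintegral_union measurableSet_Ici (Set.disjoint_left.2 fun x hx hx' => hx.2.not_ge hx')]
  have h0 : ∫⁻ s in Set.Ici (1:ℝ), volume {x | s < (f x).toReal} = 0 := by
    rw [setLIntegral_congr_fun (g := fun _ => 0) measurableSet_Ici, lintegral_zero]
    intro s hs
    have : {x | s < (f x).toReal} = ∅ := by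
      ext x
      have := ENNReal.toReal_mono ENNReal.one_ne_top (hf1 x)
      simp only [Set.mem_Ici, ENNReal.toReal_one] at hs this
      simp
      linarith
    simp [this]
  rw [h0, add_zero]
  refine setLIntegral_congr_fun measurableSet_Ioo fun s hs => ?_
  simp only [ENNReal.ofReal_lt_iff_lt_toReal hs.1.le (hfin _)]

open scoped ENNReal Pointwise in
theorem lintegral_convexCombo_le {t : ℝ} (ht : t ∈ Set.Ioo 0 1) {f g h : ℝ → ℝ≥0∞}
    (hf : Measurable f) (hg : Measurable g) (hh : Measurable h)
    (hf1 : ⨆ x, f x = 1) (hg1 : ⨆ x, g x = 1)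
    (hfgh : ∀ x y, f x ^ (1 - t) * g y ^ t ≤ h ((1 - t) * x + t * y)) :
    ENNReal.ofReal (1 - t) * (∫⁻ x, f x) + ENNReal.ofReal t * (∫⁻ x, g x) ≤ ∫⁻ x, h x := by
  have ht1 : 0 < 1 - t := sub_pos.2 ht.2
  have hmeas : ∀ k : ℝ → ℝ≥0∞, Measurable fun s : ℝ => volume {x | ENNReal.ofReal s < k x} :=
    fun k => Antitone.measurable fun s s' hs => measure_mono fun x hx =>
      (ENNReal.ofReal_le_ofReal hs).trans_lt hx
  rw [lintegral_eq_setLIntegral_Ioo_volume_lt hf fun x => hf1 ▸ le_iSup f x,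
    lintegral_eq_setLIntegral_Ioo_volume_lt hg fun x => hg1 ▸ le_iSup g x,
    ← lintegral_const_mul _ (hmeas f), ← lintegral_const_mul _ (hmeas g),
    ← lintegral_add_left ((hmeas f).const_mul _)]
  refine le_trans ?_ (lintegral_mono (f := fun x => min (h x) 1) fun x => min_le_left _ _)
  rw [lintegral_eq_setLIntegral_Ioo_volume_lt (hh.min measurable_const) fun x => min_le_right _ _]
  refine setLIntegral_mono' measurableSet_Ioo fun s hs => ?_
  have hs1 : ENNReal.ofReal s < 1 := by simpa using hs.2
  have hs0 : ENNReal.ofReal s ≠ 0 := by simpa using hs.1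
  have hne : ∀ k : ℝ → ℝ≥0∞, ⨆ x, k x = 1 → {x | ENNReal.ofReal s < k x}.Nonempty :=
    fun k hk => by
      obtain ⟨x, hx⟩ := lt_iSup_iff.1 (hk ▸ hs1)
      exact ⟨x, hx⟩
  have hsm : ∀ k : ℝ → ℝ≥0∞, ∀ r : ℝ, 0 < r → volume (r • {x | ENNReal.ofReal s < k x}) =
      ENNReal.ofReal r * volume {x | ENNReal.ofReal s < k x} := fun k r hr => by
    rw [Measure.addHaar_smul]; simp [abs_of_pos hr]
  rw [← hsm f _ ht1, ← hsm g _ ht.1]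
  refine volume_add_le_of_add_subset
    ((measurableSet_lt measurable_const hf).const_smul₀ _)
    ((measurableSet_lt measurable_const hg).const_smul₀ _)
    ((hne f hf1).smul_set) ((hne g hg1).smul_set) ?_
  rintro _ ⟨_, ⟨x, hx, rfl⟩, _, ⟨y, hy, rfl⟩, rfl⟩
  simp only [Set.mem_ofPred_eq, smul_eq_mul, lt_min_iff] at hx hy ⊢
  refine ⟨lt_of_lt_of_le ?_ (hfgh x y), hs1⟩
  calc ENNReal.ofReal s = ENNReal.ofReal s ^ (1 - t) * ENNReal.ofReal s ^ t := by
        rw [← ENNReal.rpow_add _ _ hs0 ENNReal.ofReal_ne_top]; simp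
    _ < f x ^ (1 - t) * g y ^ t := ENNReal.mul_lt_mul (ENNReal.rpow_lt_rpow hx ht1)
        (ENNReal.rpow_lt_rpow hy ht.1)

open scoped ENNReal in
/-- The conclusion of the Prékopa–Leindler inequality for the measure `μ`. -/
def PrekopaLeindler {E : Type*} [AddCommGroup E] [Module ℝ E] [MeasurableSpace E]
    (μ : Measure E) : Prop :=
  ∀ ⦃t : ℝ⦄, t ∈ Set.Ioo (0:ℝ) 1 → ∀ ⦃f g h : E → ℝ≥0∞⦄, Measurable f → Measurable g →
    Measurable h → (∀ x y, f x ^ (1 - t) * g y ^ t ≤ h ((1 - t) • x + t • y)) →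
    (∫⁻ x, f x ∂μ) ^ (1 - t) * (∫⁻ x, g x ∂μ) ^ t ≤ ∫⁻ x, h x ∂μ

open scoped ENNReal in
theorem ENNReal.geom_mean_le_arith_mean {t : ℝ} (ht : t ∈ Set.Ioo (0:ℝ) 1) (a b : ℝ≥0∞) :
    a ^ (1 - t) * b ^ t ≤ ENNReal.ofReal (1 - t) * a + ENNReal.ofReal t * b := by
  have ht1 : 0 < 1 - t := sub_pos.2 ht.2
  have h : Real.HolderConjugate (1 - t)⁻¹ t⁻¹ := by
    rw [Real.holderConjugate_iff]
    exact ⟨(one_lt_inv₀ ht1).2 (by linarith [ht.1]), by simp⟩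
  have := ENNReal.young_inequality (a ^ (1 - t)) (b ^ t) h
  rwa [← ENNReal.rpow_mul, ← ENNReal.rpow_mul, mul_inv_cancel₀ ht1.ne', mul_inv_cancel₀ ht.1.ne',
    ENNReal.rpow_one, ENNReal.rpow_one, ENNReal.ofReal_inv_of_pos ht1,
    ENNReal.ofReal_inv_of_pos ht.1, div_eq_mul_inv, div_eq_mul_inv, inv_inv, inv_inv,
    mul_comm a, mul_comm b] at this

open scoped ENNReal in
theorem prekopaLeindler_of_bounded {t : ℝ} (ht : t ∈ Set.Ioo (0:ℝ) 1) {f g h : ℝ → ℝ≥0∞}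
    (hf : Measurable f) (hg : Measurable g) (hh : Measurable h)
    (hfb : ⨆ x, f x ≠ ∞) (hgb : ⨆ x, g x ≠ ∞)
    (hfgh : ∀ x y, f x ^ (1 - t) * g y ^ t ≤ h ((1 - t) * x + t * y)) :
    (∫⁻ x, f x) ^ (1 - t) * (∫⁻ x, g x) ^ t ≤ ∫⁻ x, h x := by
  have ht1 : 0 < 1 - t := sub_pos.2 ht.2
  rcases eq_or_ne (⨆ x, f x) 0 with hf0 | hf0
  · simp [show ∀ x, f x = 0 from iSup_eq_bot.1 hf0, ENNReal.zero_rpow_of_pos ht1]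
  rcases eq_or_ne (⨆ x, g x) 0 with hg0 | hg0
  · simp [show ∀ x, g x = 0 from iSup_eq_bot.1 hg0, ENNReal.zero_rpow_of_pos ht.1]
  set α := ⨆ x, f x
  set β := ⨆ x, g x
  have hαβ : (α⁻¹ ^ (1 - t) * β⁻¹ ^ t) ≠ 0 := by
    simp [ENNReal.rpow_eq_zero_iff, hfb, hgb, hf0, hg0]
  have hαβ' : (α⁻¹ ^ (1 - t) * β⁻¹ ^ t) ≠ ∞ := by
    refine ENNReal.mul_ne_top ?_ ?_ <;> simp [ENNReal.rpow_eq_top_iff, hfb, hgb, hf0, hg0]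
  have key := lintegral_convexCombo_le ht (hf.const_mul α⁻¹) (hg.const_mul β⁻¹)
    (hh.const_mul (α⁻¹ ^ (1 - t) * β⁻¹ ^ t))
    (by rw [← ENNReal.mul_iSup, ENNReal.inv_mul_cancel hf0 hfb])
    (by rw [← ENNReal.mul_iSup, ENNReal.inv_mul_cancel hg0 hgb])
    (fun x y => by
      rw [ENNReal.mul_rpow_of_nonneg _ _ ht1.le, ENNReal.mul_rpow_of_nonneg _ _ ht.1.le,
        mul_mul_mul_comm]
      gcongr
      exact hfgh x y)
  have := (ENNReal.geom_mean_le_arith_mean ht _ _).trans key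
  rw [lintegral_const_mul _ hf, lintegral_const_mul _ hg, lintegral_const_mul _ hh,
    ENNReal.mul_rpow_of_nonneg _ _ ht1.le, ENNReal.mul_rpow_of_nonneg _ _ ht.1.le,
        mul_mul_mul_comm, ENNReal.mul_le_mul_iff_right hαβ hαβ'] at this
  exact this

open scoped ENNReal in
theorem prekopaLeindler_real : PrekopaLeindler (volume : Measure ℝ) := by
  intro t ht f g h hf hg hh hfgh
  have ht1 : 0 < 1 - t := sub_pos.2 ht.2
  rcases eq_or_ne (∫⁻ x, f x) 0 with hf0 | hf0
  · simp [hf0, ENNReal.zero_rpow_of_pos ht1]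
  rcases eq_or_ne (∫⁻ x, g x) 0 with hg0 | hg0
  · simp [hg0, ENNReal.zero_rpow_of_pos ht.1]
  have hlim : ∀ k : ℝ → ℝ≥0∞, Measurable k → Filter.Tendsto
      (fun N : ℕ => ∫⁻ x, min (k x) N) Filter.atTop (nhds (∫⁻ x, k x)) := fun k hk => by
    refine lintegral_tendsto_of_tendsto_of_monotone
      (fun N => (hk.min measurable_const).aemeasurable)
      (Filter.Eventually.of_forall fun x N M hNM => by dsimp only; gcongr)
      (Filter.Eventually.of_forall fun x => ?_)
    have := (tendsto_const_nhds (x := k x)).min ENNReal.tendsto_nat_nhds_top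
    simpa using this
  refine le_of_tendsto (ENNReal.Tendsto.mul
    ((ENNReal.continuous_rpow_const (y := 1 - t)).tendsto _ |>.comp (hlim f hf)) (Or.inl ?_)
    ((ENNReal.continuous_rpow_const (y := t)).tendsto _ |>.comp (hlim g hg)) (Or.inl ?_))
    (Filter.Eventually.of_forall fun N => ?_)
  · simp [ENNReal.rpow_eq_zero_iff, hf0, ht1.not_gt]
  · simp [ENNReal.rpow_eq_zero_iff, hg0, ht.1.not_gt]
  · have hb : ∀ k : ℝ → ℝ≥0∞, ⨆ x, min (k x) N ≠ ∞ := fun k =>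
      ((iSup_le fun x => min_le_right _ _).trans_lt (ENNReal.natCast_lt_top N)).ne
    refine prekopaLeindler_of_bounded ht (hf.min measurable_const) (hg.min measurable_const)
      hh (hb f) (hb g) fun x y => le_trans ?_ (hfgh x y)
    have := ht.1
    gcongr
    exacts [min_le_left _ _, min_le_left _ _]

theorem PrekopaLeindler.prod {E F : Type*} [AddCommGroup E] [Module ℝ E] [MeasurableSpace E]
    [AddCommGroup F] [Module ℝ F] [MeasurableSpace F] {μ : Measure E} {ν : Measure F} [SFinite ν]
    (hμ : PrekopaLeindler μ) (hν : PrekopaLeindler ν) : PrekopaLeindler (μ.prod ν) := by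
  intro t ht f g h hf hg hh hfgh
  rw [lintegral_prod _ hf.aemeasurable, lintegral_prod _ hg.aemeasurable,
    lintegral_prod _ hh.aemeasurable]
  refine hμ ht hf.lintegral_prod_right' hg.lintegral_prod_right' hh.lintegral_prod_right'
    fun x y => hν ht (hf.comp measurable_prodMk_left) (hg.comp measurable_prodMk_left)
      (hh.comp measurable_prodMk_left) fun u v => hfgh (x, u) (y, v)

theorem PrekopaLeindler.map_measurableEquiv {E F : Type*} [AddCommGroup E] [Module ℝ E]
    [MeasurableSpace E] [AddCommGroup F] [Module ℝ F] [MeasurableSpace F] {μ : Measure E}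
    {ν : Measure F} (hν : PrekopaLeindler ν) (e : E ≃ᵐ F) (he : MeasurePreserving e μ ν)
    (hlin : ∀ (r s : ℝ) x y, e.symm (r • x + s • y) = r • e.symm x + s • e.symm y) :
    PrekopaLeindler μ := by
  intro t ht f g h hf hg hh hfgh
  have key := hν ht (hf.comp e.symm.measurable) (hg.comp e.symm.measurable)
    (hh.comp e.symm.measurable) fun x y => by
      simpa only [Function.comp_apply, hlin] using hfgh (e.symm x) (e.symm y)
  simpa only [← (he.symm e).lintegral_comp hf, ← (he.symm e).lintegral_comp hg,
    ← (he.symm e).lintegral_comp hh, Function.comp_def] using key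

theorem prekopaLeindler_pi (n : ℕ) : PrekopaLeindler (volume : Measure (Fin n → ℝ)) := by
  induction n with
  | zero =>
    intro t ht f g h hf hg hh hfgh
    have hu : (volume : Measure (Fin 0 → ℝ)) Set.univ = 1 := by simp [volume_pi]
    simp only [lintegral_unique, hu, mul_one]
    convert hfgh default default
  | succ n ih =>
    refine (prekopaLeindler_real.prod ih).map_measurableEquiv
      (MeasurableEquiv.piFinSuccAbove (fun _ => ℝ) 0) (volume_preserving_piFinSuccAbove _ 0) ?_
    intro r s x y
    ext j
    refine Fin.cases ?_ (fun j => ?_) j <;> simp [MeasurableEquiv.piFinSuccAbove]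

/-- Sections of a convex body by parallel hyperplanes have log-concave volume. -/
theorem volume_insertNth_preimage_logConcave {n : ℕ} {K : Set (Fin (n + 1) → ℝ)}
    (hK : IsCompact K) (hKc : Convex ℝ K) (i : Fin (n + 1)) {t : ℝ} (ht : t ∈ Set.Ioo (0:ℝ) 1)
    (x y : ℝ) :
    volume {u : Fin n → ℝ | i.insertNth (α := fun _ => ℝ) x u ∈ K} ^ (1 - t) *
      volume {u : Fin n → ℝ | i.insertNth (α := fun _ => ℝ) y u ∈ K} ^ t ≤
      volume {u : Fin n → ℝ | i.insertNth (α := fun _ => ℝ) ((1 - t) * x + t * y) u ∈ K} := by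
  have ht1 : 0 < 1 - t := sub_pos.2 ht.2
  have hm : ∀ s : ℝ, MeasurableSet {u : Fin n → ℝ | i.insertNth (α := fun _ => ℝ) s u ∈ K} :=
    fun s => (hK.isClosed.preimage (by fun_prop)).measurableSet
  have key := prekopaLeindler_pi n ht (measurable_one.indicator (hm x))
    (measurable_one.indicator (hm y)) (measurable_one.indicator (hm ((1 - t) * x + t * y)))
    fun u v => by
      by_cases hu : i.insertNth (α := fun _ => ℝ) x u ∈ K
      · by_cases hv : i.insertNth (α := fun _ => ℝ) y v ∈ K
        · have hw : (1 - t) • u + t • v ∈ {u : Fin n → ℝ |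
              i.insertNth (α := fun _ => ℝ) ((1 - t) * x + t * y) u ∈ K} := by
            show i.insertNth (α := fun _ => ℝ) _ _ ∈ K
            convert hKc hu hv ht1.le ht.1.le (by ring) using 1
            ext j
            refine i.succAboveCases ?_ (fun j => ?_) j <;> simp
          rw [Set.indicator_of_mem hw]
          simp [hu, hv]
        · simp [hv, ENNReal.zero_rpow_of_pos ht.1]
      · simp [hu, ENNReal.zero_rpow_of_pos ht1]
  simpa [lintegral_indicator_one, hm] using key

/-- `E` occupies at most a proportion `θ` of every interval which meets `A`, and stays away
from `A`. -/
structure IsSparseNear (θ : ℝ) (E A : Set ℝ) : Prop where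
  isClosed : IsClosed A
  measurableSet : MeasurableSet E
  eventually_notMem : ∀ x ∈ A, ∀ᶠ y in nhds x, y ∉ E
  volume_inter_Icc_le : ∀ ⦃x s t : ℝ⦄, x ∈ A → x ∈ Set.Icc s t →
    volume.real (E ∩ Set.Icc s t) ≤ θ * (t - s)

namespace IsSparseNear

variable {θ : ℝ} {E A : Set ℝ}

open scoped Pointwise in
theorem neg (h : IsSparseNear θ E A) : IsSparseNear θ (-E) (-A) where
  isClosed := h.isClosed.neg
  measurableSet := h.measurableSet.neg
  eventually_notMem x hx := by
    have := (continuous_neg.tendsto x).eventually (h.eventually_notMem (-x) hx)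
    simpa using this
  volume_inter_Icc_le x s t hx hxst := by
    have h1 := h.volume_inter_Icc_le (x := -x) (s := -t) (t := -s) hx
      ⟨neg_le_neg hxst.2, neg_le_neg hxst.1⟩
    have h2 : -E ∩ Set.Icc s t = -(E ∩ Set.Icc (-t) (-s)) := by
      rw [Set.inter_neg]; simp
    rw [h2, measureReal_def, Measure.measure_neg, ← measureReal_def]
    linarith

theorem volume_inter_Icc_le_volume_diff (h : IsSparseNear θ E A) (hθ : 0 ≤ θ) {α x : ℝ}
    (hα : α ∈ A) (hx : α ≤ x) :
    volume.real (E ∩ Set.Icc α x) ≤ θ * volume.real (Set.Icc α x \ A) := by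
  set F : ℝ → ℝ := fun s => θ * volume.real (Set.Icc α s \ A) - volume.real (E ∩ Set.Icc α s)
    with hF
  have hsplit : ∀ (S : Set ℝ), MeasurableSet S → ∀ s t, α ≤ s → s ≤ t →
      volume.real (S ∩ Set.Icc α t) =
        volume.real (S ∩ Set.Icc α s) + volume.real (S ∩ Set.Icc s t) := by
    intro S hS s t hs hst
    rw [← Set.Icc_union_Icc_eq_Icc hs hst, Set.inter_union_distrib_left]
    refine measureReal_union₀ (hS.inter measurableSet_Icc).nullMeasurableSet ?_
      (measure_ne_top_of_subset Set.inter_subset_right (by simp))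
      (measure_ne_top_of_subset Set.inter_subset_right (by simp))
    refine measure_mono_null (t := {s}) ?_ (by simp)
    rintro y ⟨hy, hy'⟩
    exact le_antisymm hy.2.2 hy'.2.1
  have hFs : ∀ s t, α ≤ s → s ≤ t → F t = F s + (θ * volume.real (Set.Icc s t \ A) -
      volume.real (E ∩ Set.Icc s t)) := by
    intro s t hs hst
    have h1 := hsplit E h.measurableSet s t hs hst
    have h2 := hsplit Aᶜ h.isClosed.measurableSet.compl s t hs hst
    simp only [hF, Set.sdiff_eq, Set.inter_comm _ Aᶜ]
    rw [h1, h2]; ring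
  have hcont : ContinuousOn F (Set.Icc α x) := by
    have hlip : ∀ (S : Set ℝ), MeasurableSet S →
        ContinuousOn (fun s => volume.real (S ∩ Set.Icc α s)) (Set.Icc α x) := by
      intro S hS
      refine (LipschitzOnWith.of_dist_le_mul (K := 1) ?_).continuousOn
      have : ∀ s ∈ Set.Icc α x, ∀ t ∈ Set.Icc α x, s ≤ t →
          dist (volume.real (S ∩ Set.Icc α s)) (volume.real (S ∩ Set.Icc α t)) ≤
            (1 : NNReal) * dist s t := by
        intro s hs t ht hst
        rw [hsplit S hS s t hs.1 hst, dist_self_add_right, NNReal.coe_one, one_mul, dist_comm,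
          Real.dist_eq, abs_of_nonneg (sub_nonneg.2 hst), Real.norm_eq_abs,
          abs_of_nonneg measureReal_nonneg]
        calc _ ≤ volume.real (Set.Icc s t) :=
              measureReal_mono Set.inter_subset_right (by simp)
          _ = _ := Real.volume_real_Icc_of_le hst
      intro s hs t ht
      rcases le_total s t with hst | hst
      · exact this s hs t ht hst
      · rw [dist_comm, dist_comm s]; exact this t ht s hs hst
    simp only [hF, Set.sdiff_eq, Set.inter_comm _ Aᶜ]
    exact ((hlip _ h.isClosed.measurableSet.compl).const_smul θ).sub (hlip _ h.measurableSet)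
  have hlast : ∀ y ∈ Set.Icc α x, ∃ s ∈ A ∩ Set.Icc α y, F s ≤ F y := by
    intro y hy
    obtain ⟨s, hs, hs'⟩ := ((isCompact_Icc (a := α) (b := y)).inter_left h.isClosed).exists_isGreatest
      ⟨α, hα, ⟨le_rfl, hy.1⟩⟩
    refine ⟨s, hs, ?_⟩
    rw [hFs s y hs.2.1 hs.2.2]
    have h1 := h.volume_inter_Icc_le hs.1 (Set.left_mem_Icc.2 hs.2.2)
    have h2 : y - s = volume.real (Set.Icc s y \ A) := by
      rw [← Real.volume_real_Icc_of_le hs.2.2]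
      refine le_antisymm ?_ (measureReal_mono Set.sdiff_subset (by simp))
      calc volume.real (Set.Icc s y) = volume.real (Set.Ioc s y) := by
            rw [Real.volume_real_Icc_of_le hs.2.2, Real.volume_real_Ioc_of_le hs.2.2]
        _ ≤ _ := measureReal_mono (show Set.Ioc s y ⊆ Set.Icc s y \ A from
            fun z hz => ⟨⟨hz.1.le, hz.2⟩, fun hzA =>
              (hs' ⟨hzA, hs.2.1.trans hz.1.le, hz.2⟩).not_gt hz.1⟩)
            (measure_ne_top_of_subset Set.sdiff_subset (by simp))
    rw [← h2]
    linarith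
  by_contra! hlt
  have hFx : F x < 0 := by simp only [hF]; linarith
  obtain ⟨s₀, hs₀, hFs₀⟩ := hlast x ⟨hx, le_rfl⟩
  obtain ⟨s₁, ⟨⟨hs₁x, hs₁F⟩, hs₁A⟩, hs₁'⟩ := ((isCompact_Icc.of_isClosed_subset
    (hcont.preimage_isClosed_of_isClosed isClosed_Icc (isClosed_Iic (a := F s₀)))
    Set.inter_subset_left).inter_right h.isClosed).exists_isLeast ⟨s₀, ⟨hs₀.2, show F s₀ ≤ F s₀ from le_rfl⟩, hs₀.1⟩
  have hFα : F α = 0 := by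
    have h1 := hFs α α le_rfl le_rfl
    linarith
  simp only [Set.mem_preimage, Set.mem_Iic] at hs₁F
  have hαs₁ : α < s₁ := lt_of_le_of_ne hs₁x.1 fun h => by rw [h] at hFα; linarith
  have hev : ∀ᶠ y in nhdsWithin s₁ (Set.Iio s₁), Set.Icc y s₁ ⊆ Eᶜ := by
    obtain ⟨ε, hε, hball⟩ := Metric.eventually_nhds_iff.1 (h.eventually_notMem s₁ hs₁A)
    filter_upwards [Ioo_mem_nhdsLT (sub_lt_self s₁ hε)] with y hy z hz
    refine hball ?_
    rw [Real.dist_eq, abs_lt]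
    constructor <;> linarith [hz.1, hz.2, hy.1, hy.2]
  obtain ⟨y, hyE, hy⟩ := (hev.and (Ioo_mem_nhdsLT hαs₁)).exists
  obtain ⟨s₂, hs₂, hFs₂⟩ := hlast y ⟨hy.1.le, hy.2.le.trans hs₁x.2⟩
  have h3 := hFs y s₁ hy.1.le hy.2.le
  rw [show E ∩ Set.Icc y s₁ = ∅ from Set.disjoint_left.2 (fun z hz hz' => hyE hz' hz) |>.inter_eq,
    measureReal_empty, sub_zero] at h3
  have h4 : 0 ≤ θ * volume.real (Set.Icc y s₁ \ A) := mul_nonneg hθ measureReal_nonneg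
  have h5 := hs₁' (a := s₂) ⟨⟨⟨hs₂.2.1, hs₂.2.2.trans (hy.2.le.trans hs₁x.2)⟩, by
    simp only [Set.mem_preimage, Set.mem_Iic]; linarith⟩, hs₂.1⟩
  linarith [hs₂.2.2, hy.2]

theorem volume_inter_le_volume_diff (h : IsSparseNear θ E A) (hθ : 0 ≤ θ) {α β : ℝ}
    (hα : α ∈ A) {J : Set ℝ} (hJ : J ⊆ Set.Ioo α β)
    (hJ' : ∀ x ∈ J, Set.Ioo α x ⊆ J) :
    volume (E ∩ J) ≤ ENNReal.ofReal θ * volume (J \ A) := by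
  rcases J.eq_empty_or_nonempty with rfl | hne
  · simp
  have hbdd : BddAbove J := ⟨β, fun x hx => (hJ hx).2.le⟩
  have hασ : α ≤ sSup J := by
    obtain ⟨x, hx⟩ := hne
    exact (hJ hx).1.le.trans (le_csSup hbdd hx)
  have hsub : Set.Ioo α (sSup J) ⊆ J := by
    intro x hx
    obtain ⟨y, hy, hxy⟩ := exists_lt_of_lt_csSup hne hx.2
    exact hJ' y hy ⟨hx.1, hxy⟩
  have hsub' : J ⊆ Set.Icc α (sSup J) := fun x hx => ⟨(hJ hx).1.le, le_csSup hbdd hx⟩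
  have hfin : ∀ S ⊆ Set.Icc α (sSup J), volume S ≠ ⊤ := fun S hS =>
    measure_ne_top_of_subset hS (by simp)
  calc volume (E ∩ J) ≤ volume (E ∩ Set.Icc α (sSup J)) := by gcongr
    _ = ENNReal.ofReal (volume.real (E ∩ Set.Icc α (sSup J))) :=
        (ofReal_measureReal (hfin _ Set.inter_subset_right)).symm
    _ ≤ ENNReal.ofReal (θ * volume.real (Set.Icc α (sSup J) \ A)) :=
        ENNReal.ofReal_le_ofReal (h.volume_inter_Icc_le_volume_diff hθ hα hασ)
    _ = ENNReal.ofReal θ * volume (Set.Icc α (sSup J) \ A) := by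
        rw [ENNReal.ofReal_mul hθ, ofReal_measureReal (hfin _ Set.sdiff_subset)]
    _ ≤ ENNReal.ofReal θ * volume (J \ A) := by
        gcongr _ * ?_
        refine (measure_mono_ae ?_)
        filter_upwards [Ioo_ae_eq_Icc (μ := (volume : Measure ℝ)) (a := α) (b := sSup J)] with x hx
        intro hx'
        exact ⟨hsub (hx.mpr hx'.1), hx'.2⟩

theorem setLIntegral_le_of_antitoneOn (h : IsSparseNear θ E A) (hθ : 0 ≤ θ) {α β : ℝ}
    (hα : α ∈ A) {w : ℝ → ℝ} (hw : AntitoneOn w (Set.Ioo α β))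
    (hw0 : ∀ x ∈ Set.Ioo α β, 0 ≤ w x) :
    ∫⁻ x in E ∩ Set.Ioo α β, ENNReal.ofReal (w x) ≤
      ENNReal.ofReal θ * ∫⁻ x in Set.Ioo α β \ A, ENNReal.ofReal (w x) := by
  have hmeas : AEMeasurable w (volume.restrict (Set.Ioo α β)) :=
    aemeasurable_restrict_of_antitoneOn measurableSet_Ioo hw
  have hE := h.measurableSet.inter (measurableSet_Ioo (a := α) (b := β))
  have hD := (measurableSet_Ioo (a := α) (b := β)).diff h.isClosed.measurableSet
  rw [lintegral_eq_lintegral_meas_lt _ ((ae_restrict_iff' hE).2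
      (Filter.Eventually.of_forall fun x hx => hw0 x hx.2))
      (hmeas.mono_set Set.inter_subset_right),
    lintegral_eq_lintegral_meas_lt _ ((ae_restrict_iff' hD).2
      (Filter.Eventually.of_forall fun x hx => hw0 x hx.1))
      (hmeas.mono_set Set.sdiff_subset),
    ← lintegral_const_mul' _ _ ENNReal.ofReal_ne_top]
  refine lintegral_mono fun s => ?_
  rw [Measure.restrict_apply' hE, Measure.restrict_apply' hD]
  have := h.volume_inter_le_volume_diff hθ hα (β := β) (J := {x | s < w x} ∩ Set.Ioo α β)
    Set.inter_subset_right fun x hx y hy => ⟨hx.1.trans_le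
      (hw ⟨hy.1, hy.2.trans hx.2.2⟩ hx.2 hy.2.le), hy.1, hy.2.trans hx.2.2⟩
  convert this using 2
  · ext x; simp only [Set.mem_inter_iff]; tauto
  · congr 1; ext x; simp only [Set.mem_inter_iff, Set.mem_sdiff]; tauto

end IsSparseNear

open scoped Pointwise in
theorem setLIntegral_neg_comp_neg {S : Set ℝ} (f : ℝ → ENNReal) :
    ∫⁻ x in -S, f (-x) = ∫⁻ x in S, f x :=
  (Measure.measurePreserving_neg volume).setLIntegral_comp_preimage_emb
    (MeasurableEquiv.neg ℝ).measurableEmbedding f S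

namespace IsSparseNear

variable {θ : ℝ} {E A : Set ℝ}

theorem setLIntegral_le_of_monotoneOn (h : IsSparseNear θ E A) (hθ : 0 ≤ θ) {α β : ℝ}
    (hβ : β ∈ A) {w : ℝ → ℝ} (hw : MonotoneOn w (Set.Ioo α β))
    (hw0 : ∀ x ∈ Set.Ioo α β, 0 ≤ w x) :
    ∫⁻ x in E ∩ Set.Ioo α β, ENNReal.ofReal (w x) ≤
      ENNReal.ofReal θ * ∫⁻ x in Set.Ioo α β \ A, ENNReal.ofReal (w x) := by
  have hmem : ∀ x ∈ Set.Ioo (-β) (-α), -x ∈ Set.Ioo α β := fun x hx =>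
    ⟨by linarith [hx.2], by linarith [hx.1]⟩
  have key := h.neg.setLIntegral_le_of_antitoneOn hθ (α := -β) (β := -α) (w := fun x => w (-x))
    (by simpa using hβ) (fun x hx y hy hxy => hw (hmem y hy) (hmem x hx) (neg_le_neg hxy))
    (fun x hx => hw0 _ (hmem x hx))
  rw [← setLIntegral_neg_comp_neg (S := E ∩ Set.Ioo α β),
    ← setLIntegral_neg_comp_neg (S := Set.Ioo α β \ A), Set.inter_neg, Set.sdiff_eq,
    Set.inter_neg, Set.compl_neg, Set.neg_Ioo]
  exact key

end IsSparseNear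

open ProbabilityTheory in
theorem continuous_cdf_of_nullSingletonClass (μ : Measure ℝ) [IsProbabilityMeasure μ]
    [NullSingletonClass μ] : Continuous (cdf μ) := by
  refine continuous_iff_continuousAt.2 fun x => ?_
  rw [(monotone_cdf μ).continuousAt_iff_leftLim_eq_rightLim, (cdf μ).rightLim_eq]
  have h := (cdf μ).measure_singleton x
  rw [measure_cdf, measure_singleton, eq_comm, ENNReal.ofReal_eq_zero] at h
  exact le_antisymm ((monotone_cdf μ).leftLim_le le_rfl) (by linarith)

open ProbabilityTheory in
/-- The probability integral transform. -/
theorem map_cdf_eq_restrict (μ : Measure ℝ) [IsProbabilityMeasure μ] [NullSingletonClass μ] :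
    μ.map (cdf μ) = volume.restrict (Set.Icc 0 1) := by
  have hcont := continuous_cdf_of_nullSingletonClass μ
  have : IsProbabilityMeasure (μ.map (cdf μ)) :=
    Measure.isProbabilityMeasure_map hcont.measurable.aemeasurable
  refine Measure.ext_of_Iic _ _ fun u => ?_
  rw [Measure.map_apply hcont.measurable measurableSet_Iic,
    Measure.restrict_apply measurableSet_Iic]
  rcases le_or_gt 1 u with hu | hu
  · have h1 : cdf μ ⁻¹' Set.Iic u = Set.univ :=
      Set.eq_univ_of_forall fun x => (cdf_le_one μ x).trans hu
    have h2 : Set.Iic u ∩ Set.Icc 0 1 = Set.Icc 0 1 :=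
      Set.inter_eq_right.2 fun x hx => hx.2.trans hu
    simp [h1, h2]
  · have h2 : Set.Iic u ∩ Set.Icc 0 1 = Set.Icc 0 u := by
      ext x; simp only [Set.mem_inter_iff, Set.mem_Iic, Set.mem_Icc]
      constructor
      · rintro ⟨h1, h2, h3⟩; exact ⟨h2, h1⟩
      · rintro ⟨h1, h2⟩; exact ⟨h2, h1, h2.trans hu.le⟩
    rw [h2, Real.volume_Icc, sub_zero]
    obtain ⟨z, hz⟩ := ((tendsto_cdf_atTop μ).eventually_const_lt hu).exists
    rcases (cdf μ ⁻¹' Set.Iic u).eq_empty_or_nonempty with he | hne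
    · rw [he, measure_empty, eq_comm, ENNReal.ofReal_eq_zero]
      by_contra! h0
      obtain ⟨y, hy⟩ := ((tendsto_cdf_atBot μ).eventually_lt_const h0).exists
      exact (Set.eq_empty_iff_forall_notMem.1 he y) hy.le
    · have hbdd : BddAbove (cdf μ ⁻¹' Set.Iic u) := ⟨z, fun x hx => by
        by_contra! hzx
        exact absurd (monotone_cdf μ hzx.le) (not_le.2 (lt_of_le_of_lt hx hz))⟩
      have hx₀ := (isClosed_Iic.preimage hcont).csSup_mem hne hbdd
      set x₀ := sSup (cdf μ ⁻¹' Set.Iic u)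
      have hIic : cdf μ ⁻¹' Set.Iic u = Set.Iic x₀ := Set.Subset.antisymm
        (fun x hx => le_csSup hbdd hx) fun x hx => (monotone_cdf μ hx).trans hx₀
      rw [hIic, ← ofReal_cdf]
      congr 1
      refine le_antisymm hx₀ ?_
      by_contra! hlt
      have hx₀z : x₀ ≤ z := by
        by_contra! hzx
        exact absurd (monotone_cdf μ hzx.le) (not_le.2 (lt_of_le_of_lt hx₀ hz))
      obtain ⟨y, hy, hyu⟩ := intermediate_value_Icc hx₀z hcont.continuousOn ⟨hlt.le, hz.le⟩
      have : y ≤ x₀ := le_csSup hbdd (show cdf μ y ≤ u from hyu.le)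
      have := monotone_cdf μ this
      linarith

open ProbabilityTheory in
theorem setLIntegral_comp_cdf_le (μ : Measure ℝ) [IsProbabilityMeasure μ] [NullSingletonClass μ]
    {f : ℝ → ENNReal} (hf : Measurable f) (α β : ℝ) :
    ∫⁻ x in Set.Ioo α β, f (cdf μ x) ∂μ ≤ ∫⁻ u in Set.Icc (cdf μ α) (cdf μ β), f u := by
  have hcont := continuous_cdf_of_nullSingletonClass μ
  calc ∫⁻ x in Set.Ioo α β, f (cdf μ x) ∂μ
      ≤ ∫⁻ x in cdf μ ⁻¹' Set.Icc (cdf μ α) (cdf μ β), f (cdf μ x) ∂μ :=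
        lintegral_mono_set fun x hx => ⟨monotone_cdf μ hx.1.le, monotone_cdf μ hx.2.le⟩
    _ = ∫⁻ u in Set.Icc (cdf μ α) (cdf μ β), f u ∂(μ.map (cdf μ)) :=
        (setLIntegral_map measurableSet_Icc hf hcont.measurable).symm
    _ ≤ _ := by
        rw [map_cdf_eq_restrict]
        exact lintegral_mono' (Measure.restrict_mono le_rfl Measure.restrict_le_self) le_rfl

/-- The measure on the line with density `g`. -/
noncomputable abbrev realDensity (g : ℝ → ℝ) : Measure ℝ :=
  volume.withDensity fun x => ENNReal.ofReal (g x)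

/-- Log-concave probability densities on the line with bounded support. -/
structure IsLogConcaveDensity (g : ℝ → ℝ) : Prop where
  measurable : Measurable g
  nonneg : ∀ x, 0 ≤ g x
  rpow_mul_rpow_le : ∀ ⦃t : ℝ⦄, t ∈ Set.Ioo (0:ℝ) 1 → ∀ x y,
    g x ^ (1 - t) * g y ^ t ≤ g ((1 - t) * x + t * y)
  exists_support_subset : ∃ lo hi : ℝ, lo ≤ hi ∧ ∀ x, x ∉ Set.Ioo lo hi → g x = 0
  lintegral_eq_one : ∫⁻ x, ENNReal.ofReal (g x) = 1

namespace IsLogConcaveDensity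

variable {g : ℝ → ℝ}

theorem comp_neg (h : IsLogConcaveDensity g) : IsLogConcaveDensity fun x => g (-x) where
  measurable := h.measurable.comp measurable_neg
  nonneg x := h.nonneg _
  rpow_mul_rpow_le t ht x y := by
    convert h.rpow_mul_rpow_le ht (-x) (-y) using 2
    ring
  exists_support_subset := by
    obtain ⟨lo, hi, hlh, hg⟩ := h.exists_support_subset
    refine ⟨-hi, -lo, neg_le_neg hlh, fun x hx => hg _ fun hx' => hx ?_⟩
    exact ⟨by linarith [hx'.2], by linarith [hx'.1]⟩
  lintegral_eq_one := by
    rw [← h.lintegral_eq_one]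
    exact lintegral_neg_eq_self (μ := volume) fun x => ENNReal.ofReal (g x)

theorem mul_le_mul_of_le (h : IsLogConcaveDensity g) {x y r : ℝ} (hxy : x ≤ y) (hr : 0 ≤ r) :
    g y * g (x - r) ≤ g x * g (y - r) := by
  rcases hxy.eq_or_lt with rfl | hxy
  · exact le_rfl
  rcases hr.eq_or_lt with rfl | hr
  · simp [mul_comm]
  have hD : 0 < y - x + r := by linarith
  set s := r / (y - x + r) with hs
  have hsD : s * (y - x + r) = r := div_mul_cancel₀ _ hD.ne'
  have hs0 : 0 < s := by positivity
  have hs1 : s < 1 := by rw [hs, div_lt_one hD]; linarith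
  have h1 := h.rpow_mul_rpow_le ⟨hs0, hs1⟩ (x - r) y
  have h2 := h.rpow_mul_rpow_le (t := 1 - s) ⟨by linarith, by linarith⟩ (x - r) y
  rw [show (1 - s) * (x - r) + s * y = x by linear_combination hsD] at h1
  rw [show (1 - (1 - s)) * (x - r) + (1 - s) * y = y - r by linear_combination -hsD,
    sub_sub_cancel] at h2
  have hp : ∀ z, g z ^ (1 - s) * g z ^ s = g z := fun z => by
    rw [← Real.rpow_add' (h.nonneg z) (by norm_num)]; simp
  calc g y * g (x - r) = (g (x - r) ^ (1 - s) * g y ^ s) * (g (x - r) ^ s * g y ^ (1 - s)) := by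
        nth_rw 1 [← hp y, ← hp (x - r)]
        ring
    _ ≤ g x * g (y - r) := mul_le_mul h1 h2
        (mul_nonneg (Real.rpow_nonneg (h.nonneg _) _) (Real.rpow_nonneg (h.nonneg _) _))
        (h.nonneg _)

theorem min_le (h : IsLogConcaveDensity g) {x y z : ℝ} (hxy : x < y) (hyz : y < z) :
    min (g x) (g z) ≤ g y := by
  have hD : 0 < z - x := by linarith
  set s := (y - x) / (z - x) with hs
  have hsD : s * (z - x) = y - x := div_mul_cancel₀ _ hD.ne'
  have hs0 : 0 < s := div_pos (by linarith) hD
  have hs1 : s < 1 := by rw [hs, div_lt_one hD]; linarith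
  have h1 := h.rpow_mul_rpow_le ⟨hs0, hs1⟩ x z
  rw [show (1 - s) * x + s * z = y by linear_combination hsD] at h1
  refine le_trans ?_ h1
  have hm : 0 ≤ min (g x) (g z) := le_min (h.nonneg x) (h.nonneg z)
  calc min (g x) (g z) = min (g x) (g z) ^ (1 - s) * min (g x) (g z) ^ s := by
        rw [← Real.rpow_add' hm (by norm_num)]; simp
    _ ≤ _ := mul_le_mul (Real.rpow_le_rpow hm (min_le_left _ _) (by linarith))
        (Real.rpow_le_rpow hm (min_le_right _ _) hs0.le) (Real.rpow_nonneg hm _)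
        (Real.rpow_nonneg (h.nonneg _) _)

theorem exists_mode (h : IsLogConcaveDensity g) :
    ∃ m, MonotoneOn g (Set.Iio m) ∧ AntitoneOn g (Set.Ioi m) := by
  obtain ⟨lo, hi, hlh, hg⟩ := h.exists_support_subset
  set S := {x | ∃ y, x < y ∧ g x < g y} with hS
  have hne : S.Nonempty := by
    by_contra! hempty
    have : ∀ x, g x = 0 := by
      intro x
      by_contra hx
      have hx' : x ∈ Set.Ioo lo hi := by by_contra hx'; exact hx (hg x hx')
      refine (Set.eq_empty_iff_forall_notMem.1 hempty lo) ⟨x, hx'.1, ?_⟩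
      rw [hg lo (by simp)]
      exact lt_of_le_of_ne (h.nonneg x) (Ne.symm hx)
    simpa [this] using h.lintegral_eq_one
  have hbdd : BddAbove S := by
    refine ⟨hi, ?_⟩
    rintro x ⟨y, hxy, hgxy⟩
    by_contra! hx
    rw [hg y fun hy => by linarith [hy.2]] at hgxy
    exact (h.nonneg x).not_gt hgxy
  refine ⟨sSup S, fun x hx y hy hxy => ?_, fun x hx y hy hxy => ?_⟩
  · rcases hxy.eq_or_lt with rfl | hxy
    · exact le_rfl
    obtain ⟨z, ⟨w, hzw, hgzw⟩, hyz⟩ := exists_lt_of_lt_csSup hne hy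
    by_contra! hlt
    have h1 := h.min_le hxy (hyz.trans hzw)
    have h2 := h.min_le hyz hzw
    rcases min_le_iff.1 h1 with h1 | h1 <;> rcases min_le_iff.1 h2 with h2 | h2 <;> linarith
  · rcases hxy.eq_or_lt with rfl | hxy
    · exact le_rfl
    by_contra! hlt
    exact (not_le.2 hx) (le_csSup hbdd ⟨y, hxy, hlt⟩)

theorem isProbabilityMeasure (h : IsLogConcaveDensity g) :
    IsProbabilityMeasure (realDensity g) :=
  ⟨by rw [withDensity_apply _ MeasurableSet.univ, Measure.restrict_univ, h.lintegral_eq_one]⟩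

open ProbabilityTheory in
theorem mul_cdf_le (h : IsLogConcaveDensity g) {x y : ℝ} (hxy : x ≤ y) :
    g y * cdf (realDensity g) x ≤
      g x * cdf (realDensity g) y := by
  have := h.isProbabilityMeasure
  have hm : Measurable fun x => ENNReal.ofReal (g x) := h.measurable.ennreal_ofReal
  rw [cdf_eq_real, cdf_eq_real, ← ENNReal.ofReal_le_ofReal_iff
    (mul_nonneg (h.nonneg _) measureReal_nonneg), ENNReal.ofReal_mul (h.nonneg _),
    ENNReal.ofReal_mul (h.nonneg _), ofReal_measureReal, ofReal_measureReal,
    withDensity_apply _ measurableSet_Iic, withDensity_apply _ measurableSet_Iic,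
    ← lintegral_const_mul _ hm, ← lintegral_const_mul _ hm]
  have htr : ∫⁻ u in Set.Iic y, ENNReal.ofReal (g x) * ENNReal.ofReal (g u) =
      ∫⁻ u in Set.Iic x, ENNReal.ofReal (g x) * ENNReal.ofReal (g (u + (y - x))) := by
    have := (measurePreserving_add_right volume (y - x)).setLIntegral_comp_preimage_emb
      (MeasurableEquiv.addRight (y - x)).measurableEmbedding
      (fun u => ENNReal.ofReal (g x) * ENNReal.ofReal (g u)) (Set.Iic y)
    rw [← this]
    congr 2
    ext u; simp
  rw [htr]
  refine setLIntegral_mono' measurableSet_Iic fun u hu => ?_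
  rw [← ENNReal.ofReal_mul (h.nonneg _), ← ENNReal.ofReal_mul (h.nonneg _)]
  refine ENNReal.ofReal_le_ofReal ?_
  have := h.mul_le_mul_of_le hxy (r := x - u) (sub_nonneg.2 hu)
  rwa [sub_sub_cancel, show y - (x - u) = u + (y - x) by ring] at this

end IsLogConcaveDensity

namespace IsLogConcaveDensity

variable {g : ℝ → ℝ} {θ : ℝ} {E A : Set ℝ}

theorem setLIntegral_realDensity (h : IsLogConcaveDensity g) {S : Set ℝ} (hS : MeasurableSet S)
    (f : ℝ → ℝ) : ∫⁻ x in S, ENNReal.ofReal (f x) ∂(realDensity g) =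
      ∫⁻ x in S, ENNReal.ofReal (g x * f x) := by
  rw [setLIntegral_withDensity_eq_setLIntegral_mul_non_measurable _ h.measurable.ennreal_ofReal _ hS
    (Filter.Eventually.of_forall fun _ => ENNReal.ofReal_lt_top)]
  simp [ENNReal.ofReal_mul (h.nonneg _)]

open ProbabilityTheory

theorem setLIntegral_inv_le {a b : ℝ} (ha : 0 < a) (hab : a ≤ b) :
    ∫⁻ u in Set.Icc a b, ENNReal.ofReal u⁻¹ = ENNReal.ofReal (Real.log (b / a)) := by
  rw [← ofReal_integral_eq_lintegral_ofReal, integral_Icc_eq_integral_Ioc,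
    ← intervalIntegral.integral_of_le hab, integral_inv_of_pos ha (ha.trans_le hab)]
  · refine (continuousOn_inv₀.mono fun u hu => ?_).integrableOn_Icc
    exact (ha.trans_le hu.1).ne'
  · exact (ae_restrict_iff' measurableSet_Icc).2 (Filter.Eventually.of_forall fun u hu =>
      inv_nonneg.2 (ha.le.trans hu.1))

theorem setLIntegral_inv_cdf_le (hg : IsLogConcaveDensity g) (h : IsSparseNear θ E A) (hθ : 0 ≤ θ)
    {α β : ℝ} (hα : α ∈ A) (hαβ : α ≤ β) (hL : 0 < cdf (realDensity g) α) :
    ∫⁻ x in E ∩ Set.Ioo α β, ENNReal.ofReal (cdf (realDensity g) x)⁻¹ ∂(realDensity g) ≤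
      ENNReal.ofReal (θ * Real.log (cdf (realDensity g) β / cdf (realDensity g) α)) := by
  have := hg.isProbabilityMeasure
  have hpos : ∀ x, α ≤ x → 0 < cdf (realDensity g) x := fun x hx =>
    hL.trans_le (monotone_cdf _ hx)
  calc _ = ∫⁻ x in E ∩ Set.Ioo α β, ENNReal.ofReal (g x * (cdf (realDensity g) x)⁻¹) :=
        hg.setLIntegral_realDensity (h.measurableSet.inter measurableSet_Ioo) _
    _ ≤ ENNReal.ofReal θ *
          ∫⁻ x in Set.Ioo α β \ A, ENNReal.ofReal (g x * (cdf (realDensity g) x)⁻¹) := by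
        refine h.setLIntegral_le_of_antitoneOn hθ hα (fun x hx y hy hxy => ?_) fun x hx =>
          mul_nonneg (hg.nonneg x) (inv_nonneg.2 (hpos x hx.1.le).le)
        rw [← div_eq_mul_inv, ← div_eq_mul_inv, div_le_div_iff₀ (hpos y hy.1.le) (hpos x hx.1.le)]
        exact hg.mul_cdf_le hxy
    _ ≤ ENNReal.ofReal θ *
          ∫⁻ x in Set.Ioo α β, ENNReal.ofReal (g x * (cdf (realDensity g) x)⁻¹) := by
        gcongr
        exact Set.sdiff_subset
    _ = ENNReal.ofReal θ *
          ∫⁻ x in Set.Ioo α β, ENNReal.ofReal (cdf (realDensity g) x)⁻¹ ∂(realDensity g) := by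
        rw [hg.setLIntegral_realDensity measurableSet_Ioo]
    _ ≤ ENNReal.ofReal θ * ∫⁻ u in Set.Icc (cdf (realDensity g) α) (cdf (realDensity g) β),
          ENNReal.ofReal u⁻¹ := by
        exact mul_le_mul_right (setLIntegral_comp_cdf_le _ (f := fun u => ENNReal.ofReal u⁻¹)
          measurable_inv.ennreal_ofReal _ _) _
    _ = _ := by
        rw [setLIntegral_inv_le hL (monotone_cdf _ hαβ), ENNReal.ofReal_mul hθ]

theorem cdf_comp_neg (hg : IsLogConcaveDensity g) (x : ℝ) :
    cdf (realDensity fun x => g (-x)) (-x) = 1 - cdf (realDensity g) x := by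
  have := hg.isProbabilityMeasure
  have := hg.comp_neg.isProbabilityMeasure
  rw [cdf_eq_real, cdf_eq_real, ← probReal_compl_eq_one_sub measurableSet_Iic, Set.compl_Iic,
    measureReal_congr (μ := realDensity g) Ioi_ae_eq_Ici, measureReal_def, measureReal_def,
    withDensity_apply _ measurableSet_Ici, withDensity_apply _ measurableSet_Iic,
    ← setLIntegral_neg_comp_neg (S := Set.Ici x)]
  simp

theorem setLIntegral_inv_one_sub_cdf_le (hg : IsLogConcaveDensity g) (h : IsSparseNear θ E A)
    (hθ : 0 ≤ θ) {α β : ℝ} (hβ : β ∈ A) (hαβ : α ≤ β) (hR : 0 < 1 - cdf (realDensity g) β) :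
    ∫⁻ x in E ∩ Set.Ioo α β, ENNReal.ofReal (1 - cdf (realDensity g) x)⁻¹ ∂(realDensity g) ≤
      ENNReal.ofReal (θ * Real.log ((1 - cdf (realDensity g) α) / (1 - cdf (realDensity g) β))) := by
  have key := hg.comp_neg.setLIntegral_inv_cdf_le h.neg hθ (α := -β) (β := -α) (by simpa using hβ)
    (neg_le_neg hαβ) (by rwa [hg.cdf_comp_neg])
  have hS := h.measurableSet.inter (measurableSet_Ioo (a := α) (b := β))
  have hS' : -E ∩ Set.Ioo (-β) (-α) = -(E ∩ Set.Ioo α β) := by rw [Set.inter_neg, Set.neg_Ioo]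
  rw [hg.cdf_comp_neg, hg.cdf_comp_neg, hS', hg.comp_neg.setLIntegral_realDensity hS.neg] at key
  rw [hg.setLIntegral_realDensity hS, ← setLIntegral_neg_comp_neg]
  refine le_of_eq_of_le ?_ key
  refine lintegral_congr fun x => ?_
  rw [← hg.cdf_comp_neg, neg_neg]

end IsLogConcaveDensity

theorem rpow_add_le_one_sub {θ L R : ℝ} (hθ : 0 < θ) (hθ1 : θ ≤ 1) (hL : 0 < L) (hR : 0 < R)
    (hLR : L + R < 1) {x y : ℝ} (hx : x = (L / (1 - R)) ^ θ) (hy : y = (R / (1 - L)) ^ θ) :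
    (L + R) ^ θ ≤ x * (1 - y) / (1 - x * y) + y * (1 - x) / (1 - x * y) := by
  have aux : ∀ L R : ℝ, 0 < L → 0 < R → L + R < 1 → 0 < (L / (1 - R)) ^ θ ∧ (L / (1 - R)) ^ θ < 1 ∧
      L / (L + R) * ((L + R) ^ θ * (1 - (L / (1 - R)) ^ θ)) ≤
        (L / (1 - R)) ^ θ * (1 - (L + R) ^ θ) := by
    intro L R hL hR hLR
    have h1R : 0 < 1 - R := by linarith
    have hU : 0 < L + R := by linarith
    have hx0 : 0 < (L / (1 - R)) ^ θ := by positivity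
    have hw0 : 0 < (L + R) ^ θ := by positivity
    refine ⟨hx0, Real.rpow_lt_one (by positivity) (by rw [div_lt_one h1R]; linarith) hθ, ?_⟩
    have hy0 : (0 : ℝ) ≤ (L / (1 - R))⁻¹ := by positivity
    have ha0 : 0 ≤ R / (L + R) := by positivity
    have hb0 : 0 ≤ L / (L + R) := by positivity
    have hc := (Real.concaveOn_rpow hθ.le hθ1).2 (Set.mem_Ici.2 zero_le_one) (Set.mem_Ici.2 hy0)
      ha0 hb0 (by field_simp; ring)
    simp only [smul_eq_mul, mul_one, Real.one_rpow] at hc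
    rw [show R / (L + R) + L / (L + R) * (L / (1 - R))⁻¹ = (L + R)⁻¹ by field_simp; ring,
      Real.inv_rpow (by positivity), Real.inv_rpow (by positivity)] at hc
    set x := (L / (1 - R)) ^ θ
    set w := (L + R) ^ θ
    have h2 : R / (L + R) = 1 - L / (L + R) := by field_simp; ring
    rw [h2] at hc
    set s := L / (L + R)
    have h3 := mul_le_mul_of_nonneg_left hc (mul_pos hw0 hx0).le
    have h4 : w * x * (1 - s + s * x⁻¹) = w * x - s * w * x + s * w := by field_simp
    have h5 : w * x * w⁻¹ = x := by field_simp
    rw [h4, h5] at h3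
    linarith
  obtain ⟨hx0, hx1, hxs⟩ := aux L R hL hR hLR
  obtain ⟨hy0, hy1, hys⟩ := aux R L hR hL (by linarith)
  rw [← hx] at hx0 hx1 hxs
  rw [← hy, add_comm R L] at hys
  rw [← hy] at hy0 hy1
  have hxy : 0 < 1 - x * y := by nlinarith
  set w := (L + R) ^ θ
  rw [← add_div, le_div_iff₀ hxy]
  have h1 := mul_le_mul_of_nonneg_right hxs (sub_pos.2 hy1).le
  have h2 := mul_le_mul_of_nonneg_right hys (sub_pos.2 hx1).le
  have h3 : L / (L + R) + R / (L + R) = 1 := by field_simp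
  have h4 : R / (L + R) = 1 - L / (L + R) := by linarith
  rw [h4] at h2
  nlinarith

theorem one_sub_sub_nonpos_of_notMem {X Y u : ℝ} (hX : 0 ≤ X) (hY : 0 ≤ Y) (hXY : X + Y < 1)
    (hu0 : 0 ≤ u) (hu1 : u ≤ 1) (h0 : X = 0 ∨ 0 < u) (h1 : Y = 0 ∨ u < 1)
    (hu : u ∉ Set.Icc X (1 - Y)) :
    1 - X * (1 - Y) * u⁻¹ - Y * (1 - X) * (1 - u)⁻¹ ≤ 0 := by
  have hu0' : 0 < u := by
    rcases h0 with rfl | h0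
    · refine lt_of_le_of_ne hu0 ?_
      rintro rfl
      exact hu ⟨le_rfl, by linarith⟩
    · exact h0
  have hu1' : 0 < 1 - u := by
    rcases h1 with rfl | h1
    · rcases hu1.eq_or_lt with rfl | h
      · exact absurd ⟨by linarith, by linarith⟩ hu
      · linarith
    · linarith
  have hid : 1 - X * (1 - Y) * u⁻¹ - Y * (1 - X) * (1 - u)⁻¹ =
      -((u - X) * (u - (1 - Y))) / (u * (1 - u)) := by
    field_simp; ring
  rw [hid]
  refine div_nonpos_of_nonpos_of_nonneg (neg_nonpos.2 ?_) (mul_pos hu0' hu1').le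
  rcases lt_or_ge u X with h | h
  · exact mul_nonneg_of_nonpos_of_nonpos (by linarith) (by linarith)
  · have : 1 - Y < u := by by_contra! h'; exact hu ⟨h, h'⟩
    exact mul_nonneg (by linarith) (by linarith)

theorem nonneg_and_setLIntegral_one_sub_sub_le {X Y L R : ℝ} (hX : 0 ≤ X) (hY : 0 ≤ Y) (hXY : X + Y < 1)
    (hL0 : 0 ≤ L) (hR0 : 0 ≤ R) (h0 : X = 0 ∨ 0 < L) (h1 : Y = 0 ∨ 0 < R) :
    0 ≤ 1 - X - Y - X * (1 - Y) * Real.log ((1 - Y) / X) -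
      Y * (1 - X) * Real.log ((1 - X) / Y) ∧
    ∫⁻ u in Set.Icc L (1 - R),
      ENNReal.ofReal (1 - X * (1 - Y) * u⁻¹ - Y * (1 - X) * (1 - u)⁻¹) ≤
    ENNReal.ofReal (1 - X - Y - X * (1 - Y) * Real.log ((1 - Y) / X) -
      Y * (1 - X) * Real.log ((1 - X) / Y)) := by
  set f : ℝ → ℝ := fun u => 1 - X * (1 - Y) * u⁻¹ - Y * (1 - X) * (1 - u)⁻¹ with hf
  have hle : X ≤ 1 - Y := by linarith
  have hi1 : IntervalIntegrable (fun u => X * (1 - Y) * u⁻¹) volume X (1 - Y) := by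
    rcases hX.eq_or_lt with rfl | hX
    · simp
    · refine ContinuousOn.intervalIntegrable_of_Icc hle (continuousOn_const.mul
        (continuousOn_inv₀.mono fun u hu => ?_))
      exact (hX.trans_le hu.1).ne'
  have hi2 : IntervalIntegrable (fun u => Y * (1 - X) * (1 - u)⁻¹) volume X (1 - Y) := by
    rcases hY.eq_or_lt with rfl | hY
    · simp
    · refine ContinuousOn.intervalIntegrable_of_Icc hle (continuousOn_const.mul
        ((continuousOn_const.sub continuousOn_id).inv₀ fun u hu => ?_))
      intro (h0 : 1 - u = 0)
      linarith [hu.2]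
  have hv1 : ∫ u in X..(1 - Y), X * (1 - Y) * u⁻¹ = X * (1 - Y) * Real.log ((1 - Y) / X) := by
    rw [intervalIntegral.integral_const_mul]
    rcases hX.eq_or_lt with rfl | hX
    · simp
    · rw [integral_inv_of_pos hX (by linarith)]
  have hv2 : ∫ u in X..(1 - Y), Y * (1 - X) * (1 - u)⁻¹ =
      Y * (1 - X) * Real.log ((1 - X) / Y) := by
    rw [intervalIntegral.integral_const_mul]
    rcases hY.eq_or_lt with rfl | hY
    · simp
    · rw [intervalIntegral.integral_comp_sub_left (fun u => u⁻¹), sub_sub_cancel,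
        integral_inv_of_pos hY (by linarith)]
  have hint : IntervalIntegrable f volume X (1 - Y) :=
    (intervalIntegrable_const.sub hi1).sub hi2
  have hnonneg : ∀ u ∈ Set.Ioc X (1 - Y), 0 ≤ f u := by
    intro u hu
    rcases hu.2.eq_or_lt with rfl | hu2
    · rcases hY.eq_or_lt with rfl | hY
      · simp only [hf]; norm_num; linarith
      · have : (1:ℝ) - Y ≠ 0 := by linarith
        simp only [hf]
        rw [sub_sub_cancel]
        have h1 : X * (1 - Y) * (1 - Y)⁻¹ = X := by field_simp
        have h2 : Y * (1 - X) * Y⁻¹ = 1 - X := by field_simp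
        rw [h1, h2]; linarith
    · have hu0 : 0 < u := lt_of_le_of_lt hX hu.1
      have hu1 : 0 < 1 - u := by linarith
      have hid : f u = ((u - X) * (1 - Y - u)) / (u * (1 - u)) := by
        simp only [hf]; field_simp; ring
      rw [hid]
      exact div_nonneg (mul_nonneg (by linarith [hu.1]) (by linarith)) (mul_pos hu0 hu1).le
  have hval : ∫ u in X..(1 - Y), f u = 1 - X - Y - X * (1 - Y) * Real.log ((1 - Y) / X) -
      Y * (1 - X) * Real.log ((1 - X) / Y) := by
    simp only [hf]
    rw [intervalIntegral.integral_sub (intervalIntegrable_const.sub hi1) hi2,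
      intervalIntegral.integral_sub intervalIntegrable_const hi1, hv1, hv2]
    simp
    ring
  rw [← hval]
  refine ⟨?_, ?_⟩
  · rw [intervalIntegral.integral_of_le hle]
    exact setIntegral_nonneg measurableSet_Ioc hnonneg
  calc ∫⁻ u in Set.Icc L (1 - R), ENNReal.ofReal (f u)
      ≤ ∫⁻ u in Set.Icc X (1 - Y), ENNReal.ofReal (f u) := by
        rw [← lintegral_indicator measurableSet_Icc, ← lintegral_indicator measurableSet_Icc]
        refine lintegral_mono fun u => ?_
        by_cases huL : u ∈ Set.Icc L (1 - R)
        · by_cases hu : u ∈ Set.Icc X (1 - Y)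
          · rw [Set.indicator_of_mem huL, Set.indicator_of_mem hu]
          · rw [Set.indicator_of_mem huL, Set.indicator_of_notMem hu, nonpos_iff_eq_zero,
              ENNReal.ofReal_eq_zero]
            exact one_sub_sub_nonpos_of_notMem hX hY hXY (hL0.trans huL.1)
              (by linarith [huL.2]) (h0.imp_right fun h => h.trans_le huL.1)
              (h1.imp_right fun h => by linarith [huL.2]) hu
        · rw [Set.indicator_of_notMem huL]; exact zero_le
    _ = ∫⁻ u in Set.Ioc X (1 - Y), ENNReal.ofReal (f u) :=
        setLIntegral_congr Ioc_ae_eq_Icc.symm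
    _ = ENNReal.ofReal (∫ u in X..(1 - Y), f u) := by
        rw [intervalIntegral.integral_of_le hle, ofReal_integral_eq_lintegral_ofReal hint.1
          ((ae_restrict_iff' measurableSet_Ioc).2 (Filter.Eventually.of_forall hnonneg))]

namespace IsLogConcaveDensity

open ProbabilityTheory

variable {g : ℝ → ℝ} {θ : ℝ} {E A : Set ℝ}

theorem measure_inter_Ioo_le (hg : IsLogConcaveDensity g) (h : IsSparseNear θ E A)
    (hθ : 0 < θ) {α β L R X Y : ℝ} (hαβ : α ≤ β) (hL : cdf (realDensity g) α = L)
    (hR : 1 - cdf (realDensity g) β = R) (hX0 : 0 ≤ X) (hY0 : 0 ≤ Y) (hXY : X + Y < 1)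
    (hX : X = 0 ∨ α ∈ A ∧ 0 < L ∧ 0 < X ∧ X / (1 - Y) = (L / (1 - R)) ^ θ)
    (hY : Y = 0 ∨ β ∈ A ∧ 0 < R ∧ 0 < Y ∧ Y / (1 - X) = (R / (1 - L)) ^ θ) :
    (realDensity g).real (E ∩ Set.Ioo α β) ≤ 1 - X - Y := by
  have := hg.isProbabilityMeasure
  set μ := realDensity g with hμ
  have hcdfm : Measurable (cdf μ) := (monotone_cdf μ).measurable
  have hLR : L ≤ 1 - R := by rw [← hL, ← hR, sub_sub_cancel]; exact monotone_cdf μ hαβ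
  have hL0 : 0 ≤ L := hL ▸ cdf_nonneg μ α
  have hR0 : 0 ≤ R := by rw [← hR]; linarith [cdf_le_one μ β]
  have hlog1 : X * (1 - Y) * (θ * Real.log ((1 - R) / L)) =
      X * (1 - Y) * Real.log ((1 - Y) / X) := by
    rcases hX with rfl | ⟨-, hL0, hX0, hXe⟩
    · simp
    · rw [← Real.log_rpow (div_pos (hL0.trans_le hLR) hL0), ← inv_div L, ← inv_div X,
        Real.inv_rpow (div_pos hL0 (hL0.trans_le hLR)).le, hXe]
  have hlog2 : Y * (1 - X) * (θ * Real.log ((1 - L) / R)) =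
      Y * (1 - X) * Real.log ((1 - X) / Y) := by
    rcases hY with rfl | ⟨-, hR0, hY0, hYe⟩
    · simp
    · have : 0 < 1 - L := by linarith
      rw [← Real.log_rpow (div_pos this hR0), ← inv_div R, ← inv_div Y,
        Real.inv_rpow (div_pos hR0 this).le, hYe]
  have hc1 : ∫⁻ x in E ∩ Set.Ioo α β, ENNReal.ofReal (X * (1 - Y) * (cdf μ x)⁻¹) ∂μ ≤
      ENNReal.ofReal (X * (1 - Y) * Real.log ((1 - Y) / X)) := by
    rcases hX with rfl | ⟨hα, hL0, hX0, hXe⟩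
    · simp
    · have h1Y : 0 ≤ X * (1 - Y) := mul_nonneg hX0.le (by linarith)
      simp_rw [ENNReal.ofReal_mul h1Y]
      rw [lintegral_const_mul' _ _ ENNReal.ofReal_ne_top, ← ENNReal.ofReal_mul h1Y, ← hlog1,
        ENNReal.ofReal_mul h1Y]
      refine mul_le_mul_right ?_ _
      have := hg.setLIntegral_inv_cdf_le h hθ.le hα hαβ (by rwa [hL])
      rwa [← hμ, hL, show cdf μ β = 1 - R by rw [← hR]; ring] at this
  have hc2 : ∫⁻ x in E ∩ Set.Ioo α β, ENNReal.ofReal (Y * (1 - X) * (1 - cdf μ x)⁻¹) ∂μ ≤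
      ENNReal.ofReal (Y * (1 - X) * Real.log ((1 - X) / Y)) := by
    rcases hY with rfl | ⟨hβ, hR0, hY0, hYe⟩
    · simp
    · have h1X : 0 ≤ Y * (1 - X) := mul_nonneg hY0.le (by linarith)
      simp_rw [ENNReal.ofReal_mul h1X]
      rw [lintegral_const_mul' _ _ ENNReal.ofReal_ne_top, ← ENNReal.ofReal_mul h1X, ← hlog2,
        ENNReal.ofReal_mul h1X]
      refine mul_le_mul_right ?_ _
      have := hg.setLIntegral_inv_one_sub_cdf_le h hθ.le hβ hαβ (by rwa [hR])
      rwa [← hμ, hL, hR] at this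
  have hbd := nonneg_and_setLIntegral_one_sub_sub_le hX0 hY0 hXY hL0 hR0 (hX.imp_right fun h => h.2.1)
    (hY.imp_right fun h => h.2.1)
  have hc3 : ∫⁻ x in E ∩ Set.Ioo α β, ENNReal.ofReal
      (1 - X * (1 - Y) * (cdf μ x)⁻¹ - Y * (1 - X) * (1 - cdf μ x)⁻¹) ∂μ ≤
      ENNReal.ofReal (1 - X - Y - X * (1 - Y) * Real.log ((1 - Y) / X) -
        Y * (1 - X) * Real.log ((1 - X) / Y)) := by
    refine (lintegral_mono_set Set.inter_subset_right).trans ((setLIntegral_comp_cdf_le μ (f := fun u =>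
      ENNReal.ofReal (1 - X * (1 - Y) * u⁻¹ - Y * (1 - X) * (1 - u)⁻¹)) (by fun_prop) α β).trans ?_)
    rw [hL, show cdf μ β = 1 - R by rw [← hR]; ring]
    exact hbd.2
  have hn1 : 0 ≤ X * (1 - Y) * Real.log ((1 - Y) / X) := by
    rcases hX0.eq_or_lt with rfl | hX0
    · simp
    · refine mul_nonneg (mul_nonneg hX0.le (by linarith)) (Real.log_nonneg ?_)
      rw [one_le_div hX0]; linarith
  have hn2 : 0 ≤ Y * (1 - X) * Real.log ((1 - X) / Y) := by
    rcases hY0.eq_or_lt with rfl | hY0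
    · simp
    · refine mul_nonneg (mul_nonneg hY0.le (by linarith)) (Real.log_nonneg ?_)
      rw [one_le_div hY0]; linarith
  rw [measureReal_def]
  refine ENNReal.toReal_le_of_le_ofReal (by linarith) ?_
  calc μ (E ∩ Set.Ioo α β) = ∫⁻ x in E ∩ Set.Ioo α β, 1 ∂μ := by simp
    _ ≤ ∫⁻ x in E ∩ Set.Ioo α β, (ENNReal.ofReal (X * (1 - Y) * (cdf μ x)⁻¹) +
          ENNReal.ofReal (Y * (1 - X) * (1 - cdf μ x)⁻¹) + ENNReal.ofReal
          (1 - X * (1 - Y) * (cdf μ x)⁻¹ - Y * (1 - X) * (1 - cdf μ x)⁻¹)) ∂μ := by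
        refine lintegral_mono fun x => ?_
        calc (1 : ENNReal) = ENNReal.ofReal (X * (1 - Y) * (cdf μ x)⁻¹ +
              Y * (1 - X) * (1 - cdf μ x)⁻¹ +
              (1 - X * (1 - Y) * (cdf μ x)⁻¹ - Y * (1 - X) * (1 - cdf μ x)⁻¹)) := by
              rw [← ENNReal.ofReal_one]; congr 1; ring
          _ ≤ _ := ENNReal.ofReal_add_le.trans (add_le_add_left ENNReal.ofReal_add_le _)
    _ ≤ _ := by
        rw [lintegral_add_left (by fun_prop), lintegral_add_left (by fun_prop)]
        refine (add_le_add (add_le_add hc1 hc2) hc3).trans_eq ?_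
        rw [← ENNReal.ofReal_add hn1 hn2, ← ENNReal.ofReal_add (add_nonneg hn1 hn2) hbd.1]
        congr 1; ring

end IsLogConcaveDensity

theorem rpow_le_rpow_sub_mul {θ a U : ℝ} (hθ : 0 < θ) (hθ1 : θ ≤ 1) (ha : 0 ≤ a) (haU : a ≤ U)
    (hU : U ≤ 1) : a ^ θ ≤ U ^ θ - θ * (U - a) := by
  rcases (ha.trans haU).eq_or_lt with rfl | hU0
  · simp [le_antisymm haU ha]
  have h1 := rpow_one_add_le_one_add_mul_self (s := a / U - 1) (p := θ)
    (by have := div_nonneg ha hU0.le; linarith) hθ.le hθ1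
  rw [add_sub_cancel, Real.div_rpow ha hU0.le, div_le_iff₀ (Real.rpow_pos_of_pos hU0 _)] at h1
  have h2 : U ≤ U ^ θ := by
    simpa using Real.rpow_le_rpow_of_exponent_ge hU0 hU hθ1
  have h3 : 0 ≤ 1 - a / U := by
    rw [sub_nonneg, div_le_one hU0]; exact haU
  have h4 : U * (1 - a / U) = U - a := by field_simp
  nlinarith [mul_le_mul_of_nonneg_left (mul_le_mul_of_nonneg_right h2 h3) hθ.le]

namespace IsLogConcaveDensity

open ProbabilityTheory

variable {g : ℝ → ℝ} {θ : ℝ} {E A : Set ℝ}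

theorem measure_inter_Ioo_le_one_sub_rpow (hg : IsLogConcaveDensity g) (h : IsSparseNear θ E A)
    (hθ : 0 < θ) (hθ1 : θ ≤ 1) {α β L R : ℝ} (hαβ : α ≤ β) (hL : cdf (realDensity g) α = L)
    (hR : 1 - cdf (realDensity g) β = R) (hα : α ∈ A ∨ L = 0) (hβ : β ∈ A ∨ R = 0) :
    (realDensity g).real (E ∩ Set.Ioo α β) ≤ 1 - (L + R) ^ θ := by
  have := hg.isProbabilityMeasure
  have hLR : L ≤ 1 - R := by rw [← hL, ← hR, sub_sub_cancel]; exact monotone_cdf _ hαβ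
  have hL0 : 0 ≤ L := hL ▸ cdf_nonneg _ α
  have hR0 : 0 ≤ R := by rw [← hR]; linarith [cdf_le_one (realDensity g) β]
  rcases (show L + R ≤ 1 by linarith).eq_or_lt with hLR1 | hLR1
  · rw [hLR1, Real.one_rpow, sub_self, measureReal_def]
    refine ENNReal.toReal_le_of_le_ofReal le_rfl ?_
    calc realDensity g (E ∩ Set.Ioo α β) ≤ realDensity g (Set.Ioc α β) :=
          measure_mono fun x hx => ⟨hx.2.1, hx.2.2.le⟩
      _ = ENNReal.ofReal 0 := by
          nth_rw 1 [← measure_cdf (realDensity g)]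
          rw [StieltjesFunction.measure_Ioc, hL]
          congr 1; linarith
  rcases hL0.eq_or_lt with rfl | hL0
  · rcases hR0.eq_or_lt with rfl | hR0
    · rw [add_zero, Real.zero_rpow hθ.ne']
      rw [sub_zero]; exact measureReal_le_one
    · have h1 := hg.measure_inter_Ioo_le h hθ hαβ hL hR (X := 0) (Y := R ^ θ) le_rfl
        (by positivity) (by rw [zero_add]; exact Real.rpow_lt_one hR0.le (by linarith) hθ)
        (Or.inl rfl) (Or.inr ⟨hβ.resolve_right hR0.ne', hR0, by positivity, by simp⟩)
      simpa using h1
  · rcases hR0.eq_or_lt with rfl | hR0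
    · have h1 := hg.measure_inter_Ioo_le h hθ hαβ hL hR (X := L ^ θ) (Y := 0) (by positivity)
        le_rfl (by rw [add_zero]; exact Real.rpow_lt_one hL0.le (by linarith) hθ)
        (Or.inr ⟨hα.resolve_right hL0.ne', hL0, by positivity, by simp⟩) (Or.inl rfl)
      simpa using h1
    · have h1R : 0 < 1 - R := by linarith
      have h1L : 0 < 1 - L := by linarith
      obtain ⟨x, hx⟩ : ∃ x, x = (L / (1 - R)) ^ θ := ⟨_, rfl⟩
      obtain ⟨y, hy⟩ : ∃ y, y = (R / (1 - L)) ^ θ := ⟨_, rfl⟩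
      have hx0 : 0 < x := by rw [hx]; positivity
      have hy0 : 0 < y := by rw [hy]; positivity
      have hx1 : x < 1 := by
        rw [hx]; exact Real.rpow_lt_one (by positivity) (by rw [div_lt_one h1R]; linarith) hθ
      have hy1 : y < 1 := by
        rw [hy]; exact Real.rpow_lt_one (by positivity) (by rw [div_lt_one h1L]; linarith) hθ
      have hxy : 0 < 1 - x * y := by nlinarith
      have hyx : 1 - y * x ≠ 0 := by rw [mul_comm]; exact hxy.ne'
      have h1x : 0 < 1 - x := by linarith
      have h1y : 0 < 1 - y := by linarith
      have hXY : 1 - x * (1 - y) / (1 - x * y) - y * (1 - x) / (1 - x * y) =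
          (1 - x) * (1 - y) / (1 - x * y) := by
        field_simp; ring
      have hY1 : 1 - y * (1 - x) / (1 - x * y) = (1 - y) / (1 - x * y) := by field_simp; ring
      have hX1 : 1 - x * (1 - y) / (1 - x * y) = (1 - x) / (1 - x * y) := by field_simp; ring
      have hXY0 : 0 < (1 - x) * (1 - y) / (1 - x * y) := by positivity
      have h1 := hg.measure_inter_Ioo_le h hθ hαβ hL hR (X := x * (1 - y) / (1 - x * y))
        (Y := y * (1 - x) / (1 - x * y)) (by positivity) (by positivity) (by linarith)
        (Or.inr ⟨hα.resolve_right hL0.ne', hL0, by positivity, by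
          rw [← hx, hY1]; field_simp⟩)
        (Or.inr ⟨hβ.resolve_right hR0.ne', hR0, by positivity, by
          rw [← hy, hX1]; field_simp⟩)
      have := rpow_add_le_one_sub hθ hθ1 hL0 hR0 hLR1 hx hy
      linarith

theorem measure_inter_Iic_le (hg : IsLogConcaveDensity g) (h : IsSparseNear θ E A)
    (hθ : 0 < θ) {α m : ℝ} (hα : α ∈ A ∨ cdf (realDensity g) α = 0)
    (hm : MonotoneOn g (Set.Iio m)) (hαm : α ≤ m) :
    (realDensity g).real (E ∩ Set.Iic α) ≤
      θ * (cdf (realDensity g) α - (realDensity g).real (A ∩ Set.Iic α)) := by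
  have := hg.isProbabilityMeasure
  have hA : (realDensity g).real (A ∩ Set.Iic α) ≤ cdf (realDensity g) α := by
    rw [cdf_eq_real]; exact measureReal_mono Set.inter_subset_right
  rcases hα with hα | hα
  · obtain ⟨lo, hi, -, hsupp⟩ := hg.exists_support_subset
    have h0 : realDensity g (Set.Iic lo) = 0 := by
      rw [withDensity_apply _ measurableSet_Iic]
      rw [setLIntegral_congr_fun (g := fun _ => 0) measurableSet_Iic fun x hx => ?_, lintegral_zero]
      rw [hsupp x fun h => h.1.not_ge hx, ENNReal.ofReal_zero]
    have h1 : realDensity g (E ∩ Set.Iic α) ≤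
        ENNReal.ofReal θ * realDensity g (Set.Iic α \ A) := by
      calc realDensity g (E ∩ Set.Iic α)
          ≤ realDensity g ((E ∩ Set.Ioo lo α) ∪ (Set.Iic lo ∪ {α})) := by
            refine measure_mono fun x hx => ?_
            by_cases h1 : x ≤ lo
            · exact Or.inr (Or.inl h1)
            · rcases (show x ≤ α from hx.2).eq_or_lt with h2 | h2
              · exact Or.inr (Or.inr h2)
              · exact Or.inl ⟨hx.1, not_le.1 h1, h2⟩
        _ = realDensity g (E ∩ Set.Ioo lo α) :=
            measure_congr (union_ae_eq_left_of_ae_eq_empty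
              (ae_eq_empty.2 (measure_union_null h0 (measure_singleton _))))
        _ = ∫⁻ x in E ∩ Set.Ioo lo α, ENNReal.ofReal (g x) :=
            withDensity_apply _ (h.measurableSet.inter measurableSet_Ioo)
        _ ≤ ENNReal.ofReal θ * ∫⁻ x in Set.Ioo lo α \ A, ENNReal.ofReal (g x) :=
            h.setLIntegral_le_of_monotoneOn hθ.le hα
              (hm.mono fun x hx => hx.2.trans_le hαm) fun x _ => hg.nonneg x
        _ = ENNReal.ofReal θ * realDensity g (Set.Ioo lo α \ A) := by
            rw [withDensity_apply _ (measurableSet_Ioo.diff h.isClosed.measurableSet)]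
        _ ≤ _ := by
            gcongr
            exact fun x hx => hx.2.le
    rw [measureReal_def]
    refine ENNReal.toReal_le_of_le_ofReal (mul_nonneg hθ.le (by linarith)) (h1.trans_eq ?_)
    have h2 := measureReal_sdiff_add_inter (μ := realDensity g) (s := Set.Iic α)
      h.isClosed.measurableSet
    rw [ENNReal.ofReal_mul hθ.le, cdf_eq_real, ← ofReal_measureReal, ← h2, Set.inter_comm,
      add_sub_cancel_right]
  · have h1 : (realDensity g).real (E ∩ Set.Iic α) ≤ 0 := by
      rw [← hα, cdf_eq_real]; exact measureReal_mono Set.inter_subset_right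
    have h2 : (realDensity g).real (A ∩ Set.Iic α) = 0 :=
      le_antisymm (hA.trans hα.le) measureReal_nonneg
    rw [h2, hα]; simpa using h1

theorem measure_comp_neg (g : ℝ → ℝ) (S : Set ℝ) :
    realDensity (fun x => g (-x)) (-S) = realDensity g S := by
  rw [withDensity_apply', withDensity_apply',
    setLIntegral_neg_comp_neg (S := S) (fun x => ENNReal.ofReal (g x))]

theorem measure_inter_Ici_le (hg : IsLogConcaveDensity g) (h : IsSparseNear θ E A)
    (hθ : 0 < θ) {β m : ℝ} (hβ : β ∈ A ∨ 1 - cdf (realDensity g) β = 0)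
    (hm : AntitoneOn g (Set.Ioi m)) (hβm : m ≤ β) :
    (realDensity g).real (E ∩ Set.Ici β) ≤
      θ * (1 - cdf (realDensity g) β - (realDensity g).real (A ∩ Set.Ici β)) := by
  have h1 := hg.comp_neg.measure_inter_Iic_le h.neg hθ (α := -β) (m := -m)
    (by rwa [Set.mem_neg, neg_neg, hg.cdf_comp_neg])
    (fun x hx y hy hxy => hm (Set.mem_Ioi.2 (lt_neg.1 hy)) (Set.mem_Ioi.2 (lt_neg.1 hx)) (neg_le_neg hxy)) (neg_le_neg hβm)
  have h2 (S : Set ℝ) : -S ∩ Set.Iic (-β) = -(S ∩ Set.Ici β) := by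
    rw [Set.inter_neg, Set.neg_Ici]
  simpa only [h2, hg.cdf_comp_neg, measureReal_def, measure_comp_neg] using h1

theorem rpow_measure_le_one_sub (hg : IsLogConcaveDensity g) (h : IsSparseNear θ E A)
    (hθ : 0 < θ) (hθ1 : θ ≤ 1) :
    (realDensity g).real A ^ θ ≤ 1 - (realDensity g).real E := by
  have := hg.isProbabilityMeasure
  obtain ⟨m, hmono, hanti⟩ := hg.exists_mode
  obtain ⟨lo, hi, -, hsupp⟩ := hg.exists_support_subset
  have h0 {S : Set ℝ} (hS : MeasurableSet S) (hSd : ∀ x ∈ S, g x = 0) :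
      (realDensity g).real S = 0 := by
    rw [measureReal_def, withDensity_apply _ hS,
      setLIntegral_congr_fun (g := fun _ => 0) hS fun x hx => by
      rw [hSd x hx, ENNReal.ofReal_zero], lintegral_zero, ENNReal.toReal_zero]
  obtain ⟨α, hαm, hα, hαA⟩ : ∃ α ≤ m, (α ∈ A ∨ cdf (realDensity g) α = 0) ∧
      ∀ x ∈ A, x ≤ m → x ≤ α := by
    rcases (A ∩ Set.Iic m).eq_empty_or_nonempty with hA | hA
    · refine ⟨min lo m, min_le_right _ _, Or.inr ?_, fun x hx hxm => ?_⟩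
      · rw [cdf_eq_real]
        exact h0 measurableSet_Iic fun x hx =>
          hsupp x fun h => h.1.not_ge ((Set.mem_Iic.1 hx).trans (min_le_left _ _))
      · exact absurd (show x ∈ A ∩ Set.Iic m from ⟨hx, hxm⟩) (hA ▸ Set.notMem_empty x)
    · have hb : BddAbove (A ∩ Set.Iic m) := ⟨m, fun x hx => hx.2⟩
      have h1 := (h.isClosed.inter isClosed_Iic).csSup_mem hA hb
      exact ⟨_, h1.2, Or.inl h1.1, fun x hx hxm => le_csSup hb ⟨hx, hxm⟩⟩
  obtain ⟨β, hβm, hβ, hβA⟩ : ∃ β ≥ m, (β ∈ A ∨ 1 - cdf (realDensity g) β = 0) ∧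
      ∀ x ∈ A, m ≤ x → β ≤ x := by
    rcases (A ∩ Set.Ici m).eq_empty_or_nonempty with hA | hA
    · refine ⟨max hi m, le_max_right _ _, Or.inr ?_, fun x hx hxm => ?_⟩
      · rw [cdf_eq_real, ← probReal_compl_eq_one_sub measurableSet_Iic, Set.compl_Iic]
        exact h0 measurableSet_Ioi fun x hx =>
          hsupp x fun h => h.2.not_ge ((le_max_left _ _).trans (Set.mem_Ioi.1 hx).le)
      · exact absurd (show x ∈ A ∩ Set.Ici m from ⟨hx, hxm⟩) (hA ▸ Set.notMem_empty x)
    · have hb : BddBelow (A ∩ Set.Ici m) := ⟨m, fun x hx => hx.2⟩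
      have h1 := (h.isClosed.inter isClosed_Ici).csInf_mem hA hb
      exact ⟨_, h1.2, Or.inl h1.1, fun x hx hxm => csInf_le hb ⟨hx, hxm⟩⟩
  have hL := hg.measure_inter_Iic_le h hθ hα hmono hαm
  have hR := hg.measure_inter_Ici_le h hθ hβ hanti hβm
  have hM := hg.measure_inter_Ioo_le_one_sub_rpow h hθ hθ1 (hαm.trans hβm) rfl rfl hα hβ
  have hE : (realDensity g).real E ≤ (realDensity g).real (E ∩ Set.Iic α) +
      (realDensity g).real (E ∩ Set.Ioo α β) + (realDensity g).real (E ∩ Set.Ici β) := by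
    refine le_trans (measureReal_mono fun x hx => ?_)
      ((measureReal_union_le _ _).trans (add_le_add_left (measureReal_union_le _ _) _))
    rcases le_or_gt x α with h1 | h1
    · exact Or.inl (Or.inl ⟨hx, h1⟩)
    · rcases le_or_gt β x with h2 | h2
      · exact Or.inr ⟨hx, h2⟩
      · exact Or.inl (Or.inr ⟨hx, h1, h2⟩)
  have hA : (realDensity g).real A ≤ (realDensity g).real (A ∩ Set.Iic α) +
      (realDensity g).real (A ∩ Set.Ici β) := by
    refine le_trans (measureReal_mono fun x hx => ?_) (measureReal_union_le _ _)
    rcases le_total x m with h1 | h1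
    · exact Or.inl ⟨hx, hαA x hx h1⟩
    · exact Or.inr ⟨hx, hβA x hx h1⟩
  have haL : (realDensity g).real (A ∩ Set.Iic α) ≤ cdf (realDensity g) α := by
    rw [cdf_eq_real]; exact measureReal_mono Set.inter_subset_right
  have haR : (realDensity g).real (A ∩ Set.Ici β) ≤ 1 - cdf (realDensity g) β := by
    rw [cdf_eq_real, ← probReal_compl_eq_one_sub measurableSet_Iic, Set.compl_Iic,
      ← measureReal_congr (Ioi_ae_eq_Ici (μ := realDensity g) (a := β)).symm]
    exact measureReal_mono Set.inter_subset_right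
  have h1 := Real.rpow_le_rpow measureReal_nonneg hA hθ.le
  have h2 := rpow_le_rpow_sub_mul hθ hθ1
    (add_nonneg measureReal_nonneg measureReal_nonneg) (add_le_add haL haR)
    (by linarith [monotone_cdf (realDensity g) (hαm.trans hβm)])
  linarith

end IsLogConcaveDensity

theorem volume_setOf_two_coord_eq_zero {ι : Type*} [Fintype ι] {i j : ι} (hij : i ≠ j)
    {c s : ℝ} (hcs : c ≠ 0 ∨ s ≠ 0) (p q : ℝ) :
    volume {x : ι → ℝ | c * (x i - p) + s * (x j - q) = 0} = 0 := by
  classical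
  let S : AffineSubspace ℝ (ι → ℝ) :=
    { carrier := {x | c * (x i - p) + s * (x j - q) = 0}
      smul_vsub_vadd_mem' := fun t x y z hx hy hz => by
        simp only [Set.mem_ofPred_eq, vsub_eq_sub, vadd_eq_add, Pi.add_apply, Pi.smul_apply,
          Pi.sub_apply, smul_eq_mul] at *
        linear_combination t * hx - t * hy + hz }
  refine Measure.addHaar_affineSubspace volume S fun h => ?_
  have key (x : ι → ℝ) : c * (x i - p) + s * (x j - q) = 0 := by
    have : x ∈ S := h ▸ AffineSubspace.mem_top ℝ _ x
    exact this
  have h1 := key (fun k => if k = i then p + c else if k = j then q + s else 0)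
  simp only [if_true, if_neg hij.symm] at h1
  have : c * c + s * s = 0 := by linear_combination h1
  rcases hcs with h | h
  · nlinarith [mul_self_pos.2 h, mul_self_nonneg s]
  · nlinarith [mul_self_pos.2 h, mul_self_nonneg c]

theorem exists_setIntegral_rotated_halfspace_eq_zero {X : Type*} [MeasurableSpace X]
    {μ : Measure X} {f g φ : X → ℝ} (hf : Measurable f) (hg : Measurable g)
    (hnull : ∀ t, μ {x | Real.cos t * f x + Real.sin t * g x = 0} = 0)
    (hφ : Integrable φ μ) (hφ0 : ∫ x, φ x ∂μ = 0) :
    ∃ t, ∫ x in {x | 0 ≤ Real.cos t * f x + Real.sin t * g x}, φ x ∂μ = 0 := by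
  have hmeas (t : ℝ) : Measurable fun x => Real.cos t * f x + Real.sin t * g x := by fun_prop
  have hms (t : ℝ) : MeasurableSet {x | 0 ≤ Real.cos t * f x + Real.sin t * g x} :=
    measurableSet_le measurable_const (hmeas t)
  set H : ℝ → ℝ := fun t => ∫ x in {x | 0 ≤ Real.cos t * f x + Real.sin t * g x}, φ x ∂μ with hH
  have hind (t : ℝ) : H t =
      ∫ x, {x | 0 ≤ Real.cos t * f x + Real.sin t * g x}.indicator φ x ∂μ :=
    (integral_indicator (hms t)).symm
  have hcont : Continuous H := by
    rw [funext hind]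
    refine continuous_iff_continuousAt.2 fun t => continuousAt_of_dominated
      (bound := fun x => ‖φ x‖) (.of_forall fun t => (hφ.indicator (hms t)).aestronglyMeasurable)
      (.of_forall fun t => .of_forall fun x => norm_indicator_le_norm_self _ _) hφ.norm ?_
    have hne : ∀ᵐ x ∂μ, Real.cos t * f x + Real.sin t * g x ≠ 0 :=
      measure_eq_zero_iff_ae_notMem.1 (hnull t)
    filter_upwards [hne] with x hx
    have hc : Continuous fun t => Real.cos t * f x + Real.sin t * g x := by fun_prop
    rcases hx.lt_or_gt with h | h
    · refine (continuousAt_const (y := 0)).congr ?_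
      filter_upwards [hc.continuousAt.eventually_lt continuousAt_const h] with u hu
      exact (Set.indicator_of_notMem (by simpa using hu) _).symm
    · refine (continuousAt_const (y := φ x)).congr ?_
      filter_upwards [continuousAt_const.eventually_lt hc.continuousAt h] with u hu
      exact (Set.indicator_of_mem (by simpa using hu.le) _).symm
  have hae : {x | 0 ≤ Real.cos Real.pi * f x + Real.sin Real.pi * g x} =ᵐ[μ]
      (({x | 0 ≤ Real.cos 0 * f x + Real.sin 0 * g x} : Set X)ᶜ : Set X) := by
    refine Filter.eventuallyEq_set.2 ?_
    have hne : ∀ᵐ x ∂μ, Real.cos 0 * f x + Real.sin 0 * g x ≠ 0 :=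
      measure_eq_zero_iff_ae_notMem.1 (hnull 0)
    filter_upwards [hne] with x hx
    simp only [Real.cos_pi, Real.sin_pi, Real.cos_zero, Real.sin_zero, Set.mem_compl_iff,
      Set.mem_ofPred_eq, not_le] at hx ⊢
    constructor
    · intro h; exact lt_of_le_of_ne (by linarith) hx
    · intro h; linarith
  have hpi : H 0 + H Real.pi = 0 := by
    refine Eq.trans ?_ hφ0
    rw [← integral_add_compl (hms 0) hφ, ← setIntegral_congr_set hae]
  have h0 : (0:ℝ) ∈ Set.uIcc (H 0) (H Real.pi) := by
    rw [Set.mem_uIcc]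
    rcases le_total (H 0) 0 with h | h
    · left; constructor <;> linarith
    · right; constructor <;> linarith
  obtain ⟨t, -, ht⟩ := intermediate_value_uIcc hcont.continuousOn h0
  exact ⟨t, ht⟩

/-- A compact convex body on which two given functions have vanishing, respectively nonnegative,
integral. -/
structure IsBalancedBody {ι : Type*} [Fintype ι] (φ ψ : (ι → ℝ) → ℝ) (K : Set (ι → ℝ)) : Prop where
  isCompact : IsCompact K
  convex : Convex ℝ K
  volume_ne_zero : volume K ≠ 0
  integral_eq_zero : ∫ x in K, φ x = 0
  integral_nonneg : 0 ≤ ∫ x in K, ψ x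

namespace IsBalancedBody

variable {ι : Type*} [Fintype ι] {φ ψ : (ι → ℝ) → ℝ} {K : Set (ι → ℝ)}

theorem exists_subset_halfspace (hK : IsBalancedBody φ ψ K) (hφ : LocallyIntegrable φ)
    (hψ : LocallyIntegrable ψ) {i j : ι} (hij : i ≠ j) (p q : ℝ) :
    ∃ K' ⊆ K, IsBalancedBody φ ψ K' ∧
      ∃ c s : ℝ, (c ≠ 0 ∨ s ≠ 0) ∧ ∀ x ∈ K', 0 ≤ c * (x i - p) + s * (x j - q) := by
  have hcs (t : ℝ) : Real.cos t ≠ 0 ∨ Real.sin t ≠ 0 := by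
    by_contra! h
    have := Real.cos_sq_add_sin_sq t
    rw [h.1, h.2] at this
    norm_num at this
  have hφK := hφ.integrableOn_isCompact hK.isCompact
  have hψK := hψ.integrableOn_isCompact hK.isCompact
  obtain ⟨t, ht⟩ := exists_setIntegral_rotated_halfspace_eq_zero (μ := volume.restrict K)
    (f := fun x => x i - p) (g := fun x => x j - q) (by fun_prop) (by fun_prop)
    (fun t => le_antisymm ((Measure.restrict_apply_le _ _).trans_eq
      (volume_setOf_two_coord_eq_zero hij (hcs t) p q)) zero_le)
    hφK hK.integral_eq_zero
  set h : (ι → ℝ) → ℝ := fun x => Real.cos t * (x i - p) + Real.sin t * (x j - q) with hh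
  have hc : Continuous h := by fun_prop
  have hlin (x y : ι → ℝ) (a b : ℝ) (hab : a + b = 1) : h (a • x + b • y) = a * h x + b * h y := by
    simp only [hh, Pi.add_apply, Pi.smul_apply, smul_eq_mul]
    linear_combination (Real.cos t * p + Real.sin t * q) * hab
  have hU : IsClosed {x | 0 ≤ h x} := isClosed_le continuous_const hc
  have hL : IsClosed {x | h x ≤ 0} := isClosed_le hc continuous_const
  have hUc : Convex ℝ {x | 0 ≤ h x} := fun x hx y hy a b ha hb hab => by
    simp only [Set.mem_ofPred_eq] at *
    rw [hlin _ _ _ _ hab]; positivity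
  have hLc : Convex ℝ {x | h x ≤ 0} := fun x hx y hy a b ha hb hab => by
    simp only [Set.mem_ofPred_eq] at *
    rw [hlin _ _ _ _ hab]; nlinarith
  have hLae : {x | h x ≤ 0} =ᵐ[volume] (({x | 0 ≤ h x} : Set (ι → ℝ))ᶜ : Set (ι → ℝ)) := by
    have hne : ∀ᵐ x, h x ≠ 0 :=
      measure_eq_zero_iff_ae_notMem.1 (volume_setOf_two_coord_eq_zero hij (hcs t) p q)
    refine Filter.eventuallyEq_set.2 ?_
    filter_upwards [hne] with x hx
    exact ⟨fun h1 => not_le.2 (lt_of_le_of_ne h1 hx), fun h1 => (not_le.1 (show ¬0 ≤ h x from h1)).le⟩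
  have hsplit {f : (ι → ℝ) → ℝ} (hf : IntegrableOn f K) :
      (∫ x in K ∩ {x | 0 ≤ h x}, f x) + ∫ x in K ∩ {x | h x ≤ 0}, f x = ∫ x in K, f x := by
    rw [setIntegral_congr_set (ae_eq_set_inter (ae_eq_refl K) hLae), ← Set.sdiff_eq,
      integral_inter_add_sdiff hU.measurableSet hf]
  rw [Measure.restrict_restrict hU.measurableSet, Set.inter_comm] at ht
  have hφ' := hsplit hφK
  rw [ht, hK.integral_eq_zero, zero_add] at hφ'
  have hψ' := hsplit hψK
  have hvol : volume (K ∩ {x | 0 ≤ h x}) ≠ 0 ∨ volume (K ∩ {x | h x ≤ 0}) ≠ 0 := by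
    by_contra! h0
    refine hK.volume_ne_zero (measure_mono_null (fun x hx => ?_) (measure_union_null h0.1 h0.2))
    exact (le_total 0 (h x)).imp (fun h => ⟨hx, h⟩) fun h => ⟨hx, h⟩
  have hnn := hψ' ▸ hK.integral_nonneg
  have hcase : (volume (K ∩ {x | 0 ≤ h x}) ≠ 0 ∧ 0 ≤ ∫ x in K ∩ {x | 0 ≤ h x}, ψ x) ∨
      (volume (K ∩ {x | h x ≤ 0}) ≠ 0 ∧ 0 ≤ ∫ x in K ∩ {x | h x ≤ 0}, ψ x) := by
    by_cases h1 : volume (K ∩ {x | 0 ≤ h x}) = 0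
    · right
      rw [setIntegral_measure_zero _ h1, zero_add] at hnn
      exact ⟨hvol.resolve_left (not_not.2 h1), hnn⟩
    · by_cases h2 : volume (K ∩ {x | h x ≤ 0}) = 0
      · rw [setIntegral_measure_zero _ h2, add_zero] at hnn
        exact Or.inl ⟨h1, hnn⟩
      · rcases le_or_gt 0 (∫ x in K ∩ {x | 0 ≤ h x}, ψ x) with h3 | h3
        · exact Or.inl ⟨h1, h3⟩
        · exact Or.inr ⟨h2, by linarith⟩
  rcases hcase with ⟨h1, h2⟩ | ⟨h1, h2⟩
  · exact ⟨_, Set.inter_subset_left, ⟨hK.isCompact.inter_right hU, hK.convex.inter hUc, h1, ht, h2⟩,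
      _, _, hcs t, fun x hx => hx.2⟩
  · refine ⟨_, Set.inter_subset_left,
      ⟨hK.isCompact.inter_right hL, hK.convex.inter hLc, h1, hφ', h2⟩,
      -Real.cos t, -Real.sin t, by simpa using hcs t, fun x hx => ?_⟩
    have : h x ≤ 0 := hx.2
    simp only [hh] at this
    linarith

end IsBalancedBody

theorem mul_sub_eq_mul_sub_of_rational_halfspaces {x₁ x₂ y₁ y₂ z₁ z₂ : ℝ}
    (h : ∀ p q : ℚ, ∃ c s : ℝ, (c ≠ 0 ∨ s ≠ 0) ∧ 0 ≤ c * (x₁ - p) + s * (x₂ - q) ∧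
      0 ≤ c * (y₁ - p) + s * (y₂ - q) ∧ 0 ≤ c * (z₁ - p) + s * (z₂ - q)) :
    (y₁ - x₁) * (z₂ - x₂) = (y₂ - x₂) * (z₁ - x₁) := by
  by_contra hD
  obtain ⟨D, hDdef⟩ : ∃ D, D = (y₁ - x₁) * (z₂ - x₂) - (y₂ - x₂) * (z₁ - x₁) := ⟨_, rfl⟩
  have hD0 : D ≠ 0 := by rw [hDdef]; exact sub_ne_zero.2 hD
  let r : ℝ × ℝ → ℝ := fun w => ((w.1 - x₁) * (z₂ - x₂) - (w.2 - x₂) * (z₁ - x₁)) / D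
  let t : ℝ × ℝ → ℝ := fun w => ((y₁ - x₁) * (w.2 - x₂) - (y₂ - x₂) * (w.1 - x₁)) / D
  have hr : Continuous r := by fun_prop
  have ht : Continuous t := by fun_prop
  have hU : IsOpen {w | 0 < r w ∧ 0 < t w ∧ r w + t w < 1} :=
    (isOpen_lt continuous_const hr).inter
      ((isOpen_lt continuous_const ht).inter (isOpen_lt (hr.add ht) continuous_const))
  have hdense : DenseRange (Prod.map ((↑) : ℚ → ℝ) ((↑) : ℚ → ℝ)) :=
    Rat.denseRange_cast.prodMap Rat.denseRange_cast
  obtain ⟨⟨p, q⟩, h1, h2, h3⟩ := hdense.exists_mem_open hU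
    ⟨((x₁ + y₁ + z₁) / 3, (x₂ + y₂ + z₂) / 3), by
      have e1 : r ((x₁ + y₁ + z₁) / 3, (x₂ + y₂ + z₂) / 3) = 1 / 3 := by
        simp only [r]; rw [div_eq_iff hD0, hDdef]; ring
      have e2 : t ((x₁ + y₁ + z₁) / 3, (x₂ + y₂ + z₂) / 3) = 1 / 3 := by
        simp only [t]; rw [div_eq_iff hD0, hDdef]; ring
      simp only [Set.mem_ofPred_eq, e1, e2]; norm_num⟩
  obtain ⟨c, s, hcs, hx, hy, hz⟩ := h p q
  simp only [Prod.map_apply] at h1 h2 h3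
  have er : D * r (p, q) = (p - x₁) * (z₂ - x₂) - (q - x₂) * (z₁ - x₁) :=
    mul_div_cancel₀ _ hD0
  have et : D * t (p, q) = (y₁ - x₁) * (q - x₂) - (y₂ - x₂) * (p - x₁) :=
    mul_div_cancel₀ _ hD0
  generalize r (p, q) = r at *
  generalize t (p, q) = t at *
  have ep : (p : ℝ) = (1 - r - t) * x₁ + r * y₁ + t * z₁ := by
    apply mul_left_cancel₀ hD0
    linear_combination (p - x₁) * hDdef - (y₁ - x₁) * er - (z₁ - x₁) * et
  have eq : (q : ℝ) = (1 - r - t) * x₂ + r * y₂ + t * z₂ := by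
    apply mul_left_cancel₀ hD0
    linear_combination (q - x₂) * hDdef - (y₂ - x₂) * er - (z₂ - x₂) * et
  have hsum : (1 - r - t) * (c * (x₁ - p) + s * (x₂ - q)) + r * (c * (y₁ - p) + s * (y₂ - q)) +
      t * (c * (z₁ - p) + s * (z₂ - q)) = 0 := by
    linear_combination (-c) * ep - s * eq
  have h4 : 0 < 1 - r - t := by linarith
  have hx' := mul_nonneg h4.le hx
  have hy' := mul_nonneg h1.le hy
  have hz' := mul_nonneg h2.le hz
  have hy0 : c * (y₁ - p) + s * (y₂ - q) = 0 :=
    (mul_eq_zero.1 (show r * _ = 0 by linarith)).resolve_left h1.ne'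
  have hz0 : c * (z₁ - p) + s * (z₂ - q) = 0 :=
    (mul_eq_zero.1 (show t * _ = 0 by linarith)).resolve_left h2.ne'
  have hx0 : c * (x₁ - p) + s * (x₂ - q) = 0 :=
    (mul_eq_zero.1 (show (1 - r - t) * _ = 0 by linarith)).resolve_left h4.ne'
  rcases hcs with hc | hs
  · refine hc ((mul_eq_zero.1 ?_).resolve_right hD0)
    linear_combination c * hDdef + (z₂ - x₂) * (hy0 - hx0) - (y₂ - x₂) * (hz0 - hx0)
  · refine hs ((mul_eq_zero.1 ?_).resolve_right hD0)
    linear_combination s * hDdef + (y₁ - x₁) * (hz0 - hx0) - (z₁ - x₁) * (hy0 - hx0)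

theorem exists_forall_eq_add_smul_of_mul_sub_eq {ι : Type*} [Nonempty ι] {K : Set (ι → ℝ)}
    (hK : ∀ x ∈ K, ∀ y ∈ K, ∀ z ∈ K, ∀ i j,
      (y i - x i) * (z j - x j) = (y j - x j) * (z i - x i)) :
    ∃ (i : ι) (x v : ι → ℝ), ∀ z ∈ K, z = x + (z i - x i) • v := by
  inhabit ι
  rcases K.subsingleton_or_nontrivial with h | ⟨x, hx, y, hy, hxy⟩
  · rcases K.eq_empty_or_nonempty with rfl | ⟨x, hx⟩
    · exact ⟨default, 0, 0, by simp⟩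
    · exact ⟨default, x, 0, fun z hz => by simp [h hz hx]⟩
  · obtain ⟨i, hi⟩ := Function.ne_iff.1 hxy
    have hi' : y i - x i ≠ 0 := sub_ne_zero.2 hi.symm
    refine ⟨i, x, (y i - x i)⁻¹ • (y - x), fun z hz => funext fun j => ?_⟩
    simp only [Pi.add_apply, Pi.smul_apply, Pi.sub_apply, smul_eq_mul]
    have := hK x hx y hy z hz i j
    field_simp
    linear_combination this

theorem exists_antitone_seq_of_forall_exists_subset {X ι : Type*} [Countable ι] [Nonempty ι]
    {p : Set X → Prop} {C : ι → Set X → Prop} (h : ∀ i K, p K → ∃ K' ⊆ K, p K' ∧ C i K')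
    {K : Set X} (hK : p K) :
    ∃ S : ℕ → Set X, Antitone S ∧ S 0 = K ∧ (∀ m, p (S m)) ∧ ∀ i, ∃ m, C i (S m) := by
  obtain ⟨e, he⟩ := exists_surjective_nat ι
  choose! f hf using h
  let S : ℕ → Set X := fun m => Nat.rec K (fun k L => f (e k) L) m
  have hS (m : ℕ) : p (S m) := by
    induction m with
    | zero => exact hK
    | succ m ih => exact (hf _ _ ih).2.1
  refine ⟨S, antitone_nat_of_succ_le fun m => (hf _ _ (hS m)).1, rfl, hS, fun i => ?_⟩
  obtain ⟨m, rfl⟩ := he i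
  exact ⟨m + 1, (hf _ _ (hS m)).2.2⟩

/-- Needle localization: balanced bodies can be shrunk to a neighbourhood of a line. -/
theorem IsBalancedBody.exists_localization {ι : Type*} [Fintype ι] [Nonempty ι]
    {φ ψ : (ι → ℝ) → ℝ} {K : Set (ι → ℝ)} (hK : IsBalancedBody φ ψ K)
    (hφ : LocallyIntegrable φ) (hψ : LocallyIntegrable ψ) :
    ∃ (i : ι) (x v : ι → ℝ), ∀ f : (ι → ℝ) → ℝ, Continuous f →
      (∀ z, z = x + (z i - x i) • v → f z = 0) → ∀ ε > 0,
      ∃ K' ⊆ K, IsBalancedBody φ ψ K' ∧ ∀ z ∈ K', |f z| < ε := by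
  classical
  obtain ⟨S, hS, rfl, hSb, hcut⟩ := exists_antitone_seq_of_forall_exists_subset
    (p := IsBalancedBody φ ψ) (ι := ι × ι × ℚ × ℚ)
    (C := fun w K' => w.1 ≠ w.2.1 → ∃ c s : ℝ, (c ≠ 0 ∨ s ≠ 0) ∧
      ∀ x ∈ K', 0 ≤ c * (x w.1 - w.2.2.1) + s * (x w.2.1 - w.2.2.2))
    (fun w L hL => by
      by_cases hw : w.1 = w.2.1
      · exact ⟨L, subset_rfl, hL, fun h => absurd hw h⟩
      · obtain ⟨L', h1, h2, h3⟩ := hL.exists_subset_halfspace hφ hψ hw w.2.2.1 w.2.2.2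
        exact ⟨L', h1, h2, fun _ => h3⟩) hK
  obtain ⟨i, x, v, hline⟩ := exists_forall_eq_add_smul_of_mul_sub_eq (K := ⋂ m, S m)
    fun x hx y hy z hz i j => by
      rcases eq_or_ne i j with rfl | hij
      · rfl
      · refine mul_sub_eq_mul_sub_of_rational_halfspaces fun p q => ?_
        obtain ⟨m, hm⟩ := hcut (i, j, p, q)
        obtain ⟨c, s, hcs, h⟩ := hm hij
        rw [Set.mem_iInter] at hx hy hz
        exact ⟨c, s, hcs, h x (hx m), h y (hy m), h z (hz m)⟩
  refine ⟨i, x, v, fun f hf hf0 ε hε => ?_⟩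
  obtain ⟨m, hm⟩ := exists_subset_nhds_of_isCompact (V := S) (U := {z | |f z| < ε})
    hS.directed_ge (fun m => (hSb m).isCompact) fun z hz =>
      (isOpen_lt hf.abs continuous_const).mem_nhds (by
        simpa [hf0 z (hline z hz)] using hε)
  exact ⟨S m, hS (Nat.zero_le m), hSb m, hm⟩

theorem volume_inter_coord_preimage_eq_lintegral {n : ℕ} {K : Set (Fin (n + 1) → ℝ)}
    (hK : MeasurableSet K) (i : Fin (n + 1)) {S : Set ℝ} (hS : MeasurableSet S) :
    volume (K ∩ {z | z i ∈ S}) =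
      ∫⁻ x in S, volume {u : Fin n → ℝ | i.insertNth (α := fun _ => ℝ) x u ∈ K} := by
  have he := (volume_preserving_piFinSuccAbove (fun _ : Fin (n + 1) => ℝ) i).symm
  have hKS : MeasurableSet (K ∩ {z | z i ∈ S}) := hK.inter (measurable_pi_apply i hS)
  rw [← he.measure_preimage hKS.nullMeasurableSet, Measure.volume_eq_prod,
    Measure.prod_apply (he.measurable hKS), ← lintegral_indicator hS]
  refine lintegral_congr fun x => ?_
  by_cases hx : x ∈ S
  · rw [Set.indicator_of_mem hx]
    congr 1
    ext u
    change i.insertNth (α := fun _ => ℝ) x u ∈ K ∧ i.insertNth (α := fun _ => ℝ) x u i ∈ S ↔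
      i.insertNth (α := fun _ => ℝ) x u ∈ K
    rw [Fin.insertNth_apply_same]
    exact and_iff_left hx
  · rw [Set.indicator_of_notMem hx]
    refine measure_mono_null (fun u hu => ?_) measure_empty
    have h1 : i.insertNth (α := fun _ => ℝ) x u i ∈ S := hu.2
    rw [Fin.insertNth_apply_same] at h1
    exact absurd h1 hx

theorem measurable_volume_insertNth_preimage {n : ℕ} {K : Set (Fin (n + 1) → ℝ)}
    (hK : MeasurableSet K) (i : Fin (n + 1)) :
    Measurable fun x : ℝ => volume {u : Fin n → ℝ | i.insertNth (α := fun _ => ℝ) x u ∈ K} :=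
  measurable_measure_prodMk_left
    ((MeasurableEquiv.piFinSuccAbove (fun _ : Fin (n + 1) => ℝ) i).symm.measurable hK)

/-- The normalized volume of the section of `K` where the `i`-th coordinate is `x`. -/
noncomputable def sectionDensity {n : ℕ} (K : Set (Fin (n + 1) → ℝ)) (i : Fin (n + 1)) (x : ℝ) :
    ℝ :=
  volume.real {u : Fin n → ℝ | i.insertNth (α := fun _ => ℝ) x u ∈ K} / volume.real K

section sectionDensity

variable {n : ℕ} {K : Set (Fin (n + 1) → ℝ)}

theorem volume_insertNth_preimage_lt_top (hK : IsCompact K) (i : Fin (n + 1)) (x : ℝ) :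
    volume {u : Fin n → ℝ | i.insertNth (α := fun _ => ℝ) x u ∈ K} < ⊤ := by
  refine (measure_mono (t := (fun z : Fin (n + 1) → ℝ => fun k => z (i.succAbove k)) '' K)
    fun u hu => ⟨_, hu, funext fun k => by simp⟩).trans_lt ?_
  exact (hK.image (by fun_prop)).measure_lt_top

theorem ofReal_sectionDensity (hK : IsCompact K) (hK0 : volume K ≠ 0) (i : Fin (n + 1)) (x : ℝ) :
    ENNReal.ofReal (sectionDensity K i x) =
      volume {u : Fin n → ℝ | i.insertNth (α := fun _ => ℝ) x u ∈ K} / volume K := by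
  have hV : 0 < volume.real K := ENNReal.toReal_pos hK0 hK.measure_lt_top.ne
  rw [sectionDensity, ENNReal.ofReal_div_of_pos hV,
    ofReal_measureReal (volume_insertNth_preimage_lt_top hK i x).ne,
    ofReal_measureReal hK.measure_lt_top.ne]

theorem measure_sectionDensity (hK : IsCompact K) (hK0 : volume K ≠ 0) (i : Fin (n + 1))
    {S : Set ℝ} (hS : MeasurableSet S) :
    realDensity (sectionDensity K i) S = volume (K ∩ {z | z i ∈ S}) / volume K := by
  rw [withDensity_apply _ hS, volume_inter_coord_preimage_eq_lintegral hK.measurableSet i hS]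
  simp_rw [ofReal_sectionDensity hK hK0, div_eq_mul_inv]
  rw [lintegral_mul_const _ (measurable_volume_insertNth_preimage hK.measurableSet i)]

theorem isLogConcaveDensity_sectionDensity (hK : IsCompact K) (hKc : Convex ℝ K)
    (hK0 : volume K ≠ 0) (i : Fin (n + 1)) : IsLogConcaveDensity (sectionDensity K i) where
  measurable := (measurable_volume_insertNth_preimage hK.measurableSet i).ennreal_toReal.div_const _
  nonneg x := by unfold sectionDensity; positivity
  rpow_mul_rpow_le t ht x y := by
    have h := volume_insertNth_preimage_logConcave hK hKc i ht x y
    have h := ENNReal.toReal_mono (volume_insertNth_preimage_lt_top hK i _).ne h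
    rw [ENNReal.toReal_mul, ← ENNReal.toReal_rpow, ← ENNReal.toReal_rpow] at h
    have hV : 0 < volume.real K := ENNReal.toReal_pos hK0 hK.measure_lt_top.ne
    have hV1 : volume.real K ^ (1 - t) * volume.real K ^ t = volume.real K := by
      rw [← Real.rpow_add hV, sub_add_cancel, Real.rpow_one]
    simp only [sectionDensity]
    rw [Real.div_rpow measureReal_nonneg hV.le, Real.div_rpow measureReal_nonneg hV.le,
      div_mul_div_comm, hV1]
    exact div_le_div_of_nonneg_right h hV.le
  exists_support_subset := by
    obtain ⟨r, hr⟩ := hK.isBounded.subset_ball 0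
    refine ⟨-|r|, |r|, by linarith [abs_nonneg r], fun x hx => ?_⟩
    have h0 : {u : Fin n → ℝ | i.insertNth (α := fun _ => ℝ) x u ∈ K} = ∅ := by
      refine Set.eq_empty_of_forall_notMem fun u hu => hx ?_
      have h1 := mem_ball_zero_iff.1 (hr hu)
      have h2 := norm_le_pi_norm (i.insertNth (α := fun _ => ℝ) x u) i
      rw [Fin.insertNth_apply_same, Real.norm_eq_abs] at h2
      exact abs_lt.1 (h2.trans_lt (h1.trans_le (le_abs_self r)))
    rw [sectionDensity, h0, measureReal_empty, zero_div]
  lintegral_eq_one := by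
    have h := measure_sectionDensity hK hK0 i MeasurableSet.univ
    rw [withDensity_apply _ MeasurableSet.univ, Measure.restrict_univ] at h
    rw [h]
    simpa using ENNReal.div_self hK0 hK.measure_lt_top.ne

end sectionDensity

theorem isSparseNear_polynomial {d : ℕ} (hd : d ≠ 0) {p : Polynomial ℝ} (hp : p.natDegree ≤ d)
    {c lam : ℝ} (hc : 0 < c) (hlam : 1 ≤ lam) :
    IsSparseNear lam⁻¹ {y | |p.eval y| < c} {y | (4 * lam) ^ d * c / 2 ≤ |p.eval y|} where
  isClosed := isClosed_le continuous_const p.continuous.abs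
  measurableSet := (isOpen_lt p.continuous.abs continuous_const).measurableSet
  eventually_notMem x hx := by
    have h4 : 4 * 1 ≤ (4 * lam) ^ d :=
      (by linarith : 4 * 1 ≤ 4 * lam).trans (le_self_pow₀ (by linarith) hd)
    have h1 : c < |p.eval x| := lt_of_lt_of_le (by nlinarith) (show _ ≤ _ from hx)
    filter_upwards [(continuous_const.tendsto x).eventually_lt
      (p.continuous.abs.tendsto x) h1] with y hy h
    exact lt_asymm hy h
  volume_inter_Icc_le x s t hx hxs :=
    volume_sublevel_inter_Icc_le hd hp hc (by linarith) hxs hx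

/-- The comparison inequality for a body on which the polynomial almost depends on one coordinate. -/
theorem volume_div_le_rpow_of_near_polynomial {n d : ℕ} (hd : d ≠ 0) {K : Set (Fin (n + 1) → ℝ)}
    (hK : IsCompact K) (hKc : Convex ℝ K) (hK0 : volume K ≠ 0) (i : Fin (n + 1))
    {p : Polynomial ℝ} (hp : p.natDegree ≤ d) {f : (Fin (n + 1) → ℝ) → ℝ}
    {c lam : ℝ} (hc : 0 < c) (hlam : 1 ≤ lam)
    (hfp : ∀ z ∈ K, |(|f z| - |p.eval (z i)|)| < c / 3) :
    volume.real (K ∩ {z | (4 * lam) ^ d * c ≤ |f z|}) / volume.real K ≤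
      (volume.real (K ∩ {z | c ≤ |f z|}) / volume.real K) ^ lam := by
  have h4 : 4 * 1 ≤ (4 * lam) ^ d :=
    (by linarith : 4 * 1 ≤ 4 * lam).trans (le_self_pow₀ (by linarith) hd)
  have hV : 0 < volume.real K := ENNReal.toReal_pos hK0 hK.measure_lt_top.ne
  have hlam0 : 0 < lam := by linarith
  have hs := isSparseNear_polynomial hd hp (c := c + c / 3) (by positivity) hlam
  have hg := isLogConcaveDensity_sectionDensity hK hKc hK0 i
  have := hg.isProbabilityMeasure
  have h := hg.rpow_measure_le_one_sub hs (inv_pos.2 hlam0) (inv_le_one_of_one_le₀ hlam)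
  rw [← probReal_compl_eq_one_sub hs.measurableSet, measureReal_def, measureReal_def,
    measure_sectionDensity hK hK0 i hs.isClosed.measurableSet,
    measure_sectionDensity hK hK0 i hs.measurableSet.compl, ENNReal.toReal_div,
    ENNReal.toReal_div] at h
  have hA : volume.real (K ∩ {z | (4 * lam) ^ d * c ≤ |f z|}) ≤ volume.real
      (K ∩ {z | z i ∈ {y | (4 * lam) ^ d * (c + c / 3) / 2 ≤ |p.eval y|}}) := by
    refine measureReal_mono (fun z hz => ⟨hz.1, ?_⟩)
      (measure_inter_lt_top_of_left_ne_top hK.measure_lt_top.ne).ne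
    have h1 := (abs_lt.1 (hfp z hz.1)).2
    have h2 : (4 * lam) ^ d * c ≤ |f z| := hz.2
    change (4 * lam) ^ d * (c + c / 3) / 2 ≤ |p.eval (z i)|
    nlinarith
  have hB : volume.real (K ∩ {z | z i ∈ {y | |p.eval y| < c + c / 3}ᶜ}) ≤
      volume.real (K ∩ {z | c ≤ |f z|}) := by
    refine measureReal_mono (fun z hz => ⟨hz.1, ?_⟩)
      (measure_inter_lt_top_of_left_ne_top hK.measure_lt_top.ne).ne
    have h1 := (abs_lt.1 (hfp z hz.1)).1
    have h2 : ¬ |p.eval (z i)| < c + c / 3 := hz.2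
    change c ≤ |f z|
    linarith
  rw [← Real.rpow_inv_le_iff_of_pos (by positivity) (by positivity) hlam0]
  calc _ ≤ _ := Real.rpow_le_rpow (by positivity) (div_le_div_of_nonneg_right hA hV.le)
        (inv_pos.2 hlam0).le
    _ ≤ _ := h
    _ ≤ _ := div_le_div_of_nonneg_right hB hV.le

theorem integral_indicator_sub_const {X : Type*} [MeasurableSpace X] {μ : Measure X}
    {K S : Set X} (hK : μ K ≠ ⊤) (hS : MeasurableSet S) (r : ℝ) :
    ∫ x in K, (S.indicator 1 x - r) ∂μ = μ.real (K ∩ S) - r * μ.real K := by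
  have : IsFiniteMeasure (μ.restrict K) := isFiniteMeasure_restrict.2 hK
  have hi : Integrable (S.indicator (1 : X → ℝ)) (μ.restrict K) :=
    (integrable_const (1 : ℝ)).indicator hS
  rw [integral_sub hi (integrable_const _), integral_indicator_one hS,
    measureReal_restrict_apply hS, Set.inter_comm, setIntegral_const, smul_eq_mul, mul_comm]

theorem locallyIntegrable_indicator_sub_const {X : Type*} [MeasurableSpace X] [TopologicalSpace X]
    [OpensMeasurableSpace X] {μ : Measure X} [IsLocallyFiniteMeasure μ]
    {S : Set X} (hS : MeasurableSet S) (r : ℝ) :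
    LocallyIntegrable (fun x => S.indicator (1 : X → ℝ) x - r) μ :=
  ((locallyIntegrable_const (1 : ℝ)).indicator hS).sub (locallyIntegrable_const r)

/-- The restriction of `P` to the line `s ↦ x + (s - x i) • v`. -/
noncomputable def MvPolynomial.restrictLine {ι : Type*} (P : MvPolynomial ι ℝ) (i : ι)
    (x v : ι → ℝ) : Polynomial ℝ :=
  MvPolynomial.aeval (fun k => Polynomial.C (x k) +
    (Polynomial.X - Polynomial.C (x i)) * Polynomial.C (v k)) P

theorem MvPolynomial.natDegree_restrictLine_le {ι : Type*} {P : MvPolynomial ι ℝ} {d : ℕ}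
    (hP : P.totalDegree ≤ d) (i : ι) (x v : ι → ℝ) : (P.restrictLine i x v).natDegree ≤ d := by
  simpa [restrictLine] using MvPolynomial.aeval_natDegree_le P hP (fun k => Polynomial.C (x k) +
    (Polynomial.X - Polynomial.C (x i)) * Polynomial.C (v k)) (n := 1) fun k => by compute_degree

theorem MvPolynomial.eval_restrictLine {ι : Type*} (P : MvPolynomial ι ℝ) (i : ι) (x v : ι → ℝ)
    (s : ℝ) : (P.restrictLine i x v).eval s = MvPolynomial.eval (x + (s - x i) • v) P := by
  unfold restrictLine
  induction P using MvPolynomial.induction_on with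
  | C a => simp
  | add p q hp hq => simp [hp, hq]
  | mul_X p k hp => simp [hp]

theorem volume_div_le_rpow {n d : ℕ} (hd : d ≠ 0) {P : MvPolynomial (Fin (n + 1)) ℝ}
    (hP : P.totalDegree ≤ d) {K : Set (Fin (n + 1) → ℝ)} (hK : IsCompact K) (hKc : Convex ℝ K)
    (hK0 : volume K ≠ 0) {c lam : ℝ} (hc : 0 < c) (hlam : 1 ≤ lam) :
    volume.real (K ∩ {z | (4 * lam) ^ d * c ≤ |MvPolynomial.eval z P|}) / volume.real K ≤
      (volume.real (K ∩ {z | c ≤ |MvPolynomial.eval z P|}) / volume.real K) ^ lam := by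
  have hf : Continuous fun z => MvPolynomial.eval z P := MvPolynomial.continuous_eval P
  have hS (r : ℝ) : MeasurableSet {z | r ≤ |MvPolynomial.eval z P|} :=
    measurableSet_le measurable_const hf.abs.measurable
  have hV : volume.real K ≠ 0 := (ENNReal.toReal_pos hK0 hK.measure_lt_top.ne).ne'
  set A : Set (Fin (n + 1) → ℝ) := {z | (4 * lam) ^ d * c ≤ |MvPolynomial.eval z P|} with hA
  set B : Set (Fin (n + 1) → ℝ) := {z | c ≤ |MvPolynomial.eval z P|} with hB
  set a := volume.real (K ∩ A) / volume.real K with ha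
  set b := volume.real (K ∩ B) / volume.real K with hb
  have hbody : IsBalancedBody (fun z => B.indicator 1 z - b) (fun z => A.indicator 1 z - a) K :=
    ⟨hK, hKc, hK0, by
      rw [integral_indicator_sub_const hK.measure_lt_top.ne (hS _), hb, div_mul_cancel₀ _ hV,
        sub_self], by
      rw [integral_indicator_sub_const hK.measure_lt_top.ne (hS _), ha, div_mul_cancel₀ _ hV,
        sub_self]⟩
  obtain ⟨i, x, v, h⟩ := hbody.exists_localization
    (locallyIntegrable_indicator_sub_const (hS _) b)
    (locallyIntegrable_indicator_sub_const (hS _) a)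
  obtain ⟨K', -, hK', hnear⟩ := h
    (fun z => |MvPolynomial.eval z P| - |(P.restrictLine i x v).eval (z i)|)
    (hf.abs.sub ((P.restrictLine i x v).continuous.comp (continuous_apply i)).abs)
    (fun z hz => by rw [MvPolynomial.eval_restrictLine, ← hz, sub_self]) (c / 3) (by positivity)
  have hV' : 0 < volume.real K' :=
    ENNReal.toReal_pos hK'.volume_ne_zero hK'.isCompact.measure_lt_top.ne
  have h1 := volume_div_le_rpow_of_near_polynomial hd hK'.isCompact hK'.convex hK'.volume_ne_zero i
    (MvPolynomial.natDegree_restrictLine_le hP i x v) hc hlam hnear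
  have h2 := hK'.integral_eq_zero
  have h3 := hK'.integral_nonneg
  rw [integral_indicator_sub_const hK'.isCompact.measure_lt_top.ne (hS _), sub_eq_zero,
    ← div_eq_iff hV'.ne'] at h2
  rw [integral_indicator_sub_const hK'.isCompact.measure_lt_top.ne (hS _), sub_nonneg,
    ← le_div_iff₀ hV'] at h3
  rw [← h2]
  exact h3.trans h1

/-- The dimension-free comparison lemma: for a polynomial `P` of degree at most `d`
on `ℝⁿ` and a compact convex set `F` of volume one, for every `c > 0` and `λ ≥ 1`,
`Vol{x ∈ F : |P(x)| ≥ (4λ)^d c} ≤ (Vol{x ∈ F : |P(x)| ≥ c})^λ`. -/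
theorem comparison_lemma {n : ℕ} (d : ℕ) (P : MvPolynomial (Fin n) ℝ)
    (hPd : P.totalDegree ≤ d)
    (F : Set (EuclideanSpace ℝ (Fin n))) (hFcomp : IsCompact F) (hFconv : Convex ℝ F)
    (hFvol : volume F = 1)
    (c : ℝ) (hc : 0 < c) (lam : ℝ) (hlam : 1 ≤ lam) :
    (volume {x ∈ F | (4 * lam) ^ d * c ≤ |MvPolynomial.eval (fun i => x i) P|}).toReal ≤
      (volume {x ∈ F | c ≤ |MvPolynomial.eval (fun i => x i) P|}).toReal ^ lam := by
  by_cases hconst : ∀ x y, MvPolynomial.eval x P = MvPolynomial.eval y P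
  · have hle : {x ∈ F | (4 * lam) ^ d * c ≤ |MvPolynomial.eval (fun i => x i) P|} ⊆
        {x ∈ F | c ≤ |MvPolynomial.eval (fun i => x i) P|} := fun x hx =>
      ⟨hx.1, le_trans (le_mul_of_one_le_left hc.le (one_le_pow₀ (by linarith))) hx.2⟩
    by_cases h0 : c ≤ |MvPolynomial.eval 0 P|
    · have hF : {x ∈ F | c ≤ |MvPolynomial.eval (fun i => x i) P|} = F :=
        Set.sep_eq_self_iff_mem_true.2 fun x _ => hconst 0 _ ▸ h0
      rw [hF] at hle ⊢
      rw [hFvol, ENNReal.toReal_one, Real.one_rpow]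
      exact ENNReal.toReal_le_of_le_ofReal zero_le_one (by
        simpa [hFvol] using measure_mono (μ := volume) hle)
    · have hF : {x ∈ F | c ≤ |MvPolynomial.eval (fun i => x i) P|} = ∅ :=
        Set.sep_eq_empty_iff_mem_false.2 fun x _ => hconst 0 _ ▸ h0
      rw [hF] at hle ⊢
      rw [Set.subset_empty_iff.1 hle, measure_empty, ENNReal.toReal_zero]
      positivity
  · have hd : d ≠ 0 := by
      rintro rfl
      rw [MvPolynomial.totalDegree_eq_zero_iff_eq_C.1 (Nat.le_zero.1 hPd)] at hconst
      simp at hconst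
    obtain _ | n := n
    · exact absurd (fun x y => by rw [Subsingleton.elim x y]) hconst
    have hmp := PiLp.volume_preserving_toLp (Fin (n + 1))
    have hvol {r : ℝ} : volume {x ∈ F | r ≤ |MvPolynomial.eval (fun i => x i) P|} =
        volume (WithLp.toLp 2 ⁻¹' F ∩ {z | r ≤ |MvPolynomial.eval z P|}) := by
      refine (hmp.measure_preimage ?_).symm
      have hc : Continuous fun x : EuclideanSpace ℝ (Fin (n + 1)) =>
          MvPolynomial.eval (fun i => x i) P :=
        (MvPolynomial.continuous_eval P).comp (PiLp.continuous_ofLp 2 _)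
      exact (hFcomp.isClosed.inter (isClosed_le continuous_const hc.abs)).nullMeasurableSet
    have hK1 : volume (WithLp.toLp 2 ⁻¹' F : Set (Fin (n + 1) → ℝ)) = 1 := by
      rw [hmp.measure_preimage hFcomp.measurableSet.nullMeasurableSet, hFvol]
    have hK : IsCompact (WithLp.toLp 2 ⁻¹' F : Set (Fin (n + 1) → ℝ)) :=
      (PiLp.homeomorph 2 _).symm.isCompact_preimage.2 hFcomp
    have hKc : Convex ℝ (WithLp.toLp 2 ⁻¹' F : Set (Fin (n + 1) → ℝ)) :=
      hFconv.linear_preimage (WithLp.linearEquiv 2 ℝ (Fin (n + 1) → ℝ)).symm.toLinearMap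
    have h := volume_div_le_rpow hd hPd hK hKc (by rw [hK1]; exact one_ne_zero) hc hlam
    rw [hvol, hvol]
    simpa only [measureReal_def, hK1, ENNReal.toReal_one, div_one] using h
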